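/- arXiv:0905.4119 — 11 statements merged into one kernel-verified Lean document; each statement's English description precedes it below -/
import Mathlib

section
/- Let q1, q2 be C² on a neighborhood of [0,1]. For u > 0 and m with c = m/u ∈ [0,1], define the eigenvalue λ(u,m) = H(m/u)/u and the eigenvector r(c) = (h'(c), 1 + q1'(c)). Then the directional derivative of λ at (u,m) in the direction r(c) equals H(c)·f''(c)/u², i.e. ∂λ/∂u·h'(c) + ∂λ/∂m·(1 + q1'(c)) = H(c)·f''(c)/u². In particular λ is genuinely nonlinear in every region where f'' does not vanish. -/
open Set

/-- `h = q1 + q2`. -/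
noncomputable def hFun (q1 q2 : ℝ → ℝ) : ℝ → ℝ := fun c => q1 c + q2 c

/-- `f(c) = q1(c) - c·h(c)`. -/
noncomputable def fFun (q1 q2 : ℝ → ℝ) : ℝ → ℝ := fun c => q1 c - c * hFun q1 q2 c

/-- `H(c) = 1 + q1'(c) - c·h'(c)`. -/
noncomputable def HFun (q1 q2 : ℝ → ℝ) : ℝ → ℝ :=
  fun c => 1 + deriv q1 c - c * deriv (hFun q1 q2) c

/-- The directional derivative of the eigenvalue `λ(u,m) = H(m/u)/u` in the
direction of the eigenvector `r(c) = (h'(c), 1 + q1'(c))` equals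
`H(c)·f''(c)/u²`, where `c = m/u`. -/
theorem directional_deriv_lambda_eq
    (q1 q2 : ℝ → ℝ)
    (hreg : ∃ U : Set ℝ, IsOpen U ∧ Icc (0:ℝ) 1 ⊆ U ∧
      ContDiffOn ℝ 2 q1 U ∧ ContDiffOn ℝ 2 q2 U)
    (u m : ℝ) (hu : 0 < u) (hc : m / u ∈ Icc (0:ℝ) 1) :
    deriv (fun u' => HFun q1 q2 (m / u') / u') u * deriv (hFun q1 q2) (m / u)
      + deriv (fun m' => HFun q1 q2 (m' / u) / u) m * (1 + deriv q1 (m / u))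
    = HFun q1 q2 (m / u) * deriv (deriv (fFun q1 q2)) (m / u) / u ^ 2 := by
  obtain ⟨U, hU, hsub, h1, h2⟩ := hreg
  have hcU : m / u ∈ U := hsub hc
  have hh : ContDiffOn ℝ 2 (hFun q1 q2) U := h1.add h2
  have hune : u ≠ 0 := hu.ne'
  have d1 : ∀ x ∈ U, HasDerivAt q1 (deriv q1 x) x := fun x hx =>
    ((h1.differentiableOn (by norm_num)).differentiableAt (hU.mem_nhds hx)).hasDerivAt
  have dh : ∀ x ∈ U, HasDerivAt (hFun q1 q2) (deriv (hFun q1 q2) x) x := fun x hx =>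
    ((hh.differentiableOn (by norm_num)).differentiableAt (hU.mem_nhds hx)).hasDerivAt
  have dd1 : HasDerivAt (deriv q1) (deriv (deriv q1) (m / u)) (m / u) :=
    (((h1.deriv_of_isOpen (m := 1) hU (by norm_num)).differentiableOn
      (by norm_num)).differentiableAt (hU.mem_nhds hcU)).hasDerivAt
  have ddh : HasDerivAt (deriv (hFun q1 q2)) (deriv (deriv (hFun q1 q2)) (m / u)) (m / u) :=
    (((hh.deriv_of_isOpen (m := 1) hU (by norm_num)).differentiableOn
      (by norm_num)).differentiableAt (hU.mem_nhds hcU)).hasDerivAt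
  have hidm : HasDerivAt (fun x : ℝ => x) 1 (m / u) := hasDerivAt_id' _
  have dH : HasDerivAt (HFun q1 q2) (deriv (deriv q1) (m / u) -
      (1 * deriv (hFun q1 q2) (m / u) + m / u * deriv (deriv (hFun q1 q2)) (m / u))) (m / u) :=
    (dd1.const_add 1).sub (hidm.mul ddh)
  have df : deriv (fFun q1 q2) =ᶠ[nhds (m / u)]
      fun x => deriv q1 x - (1 * hFun q1 q2 x + x * deriv (hFun q1 q2) x) := by
    filter_upwards [hU.mem_nhds hcU] with x hx
    exact ((d1 x hx).sub ((hasDerivAt_id' x).mul (dh x hx))).deriv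
  have ddf : deriv (deriv (fFun q1 q2)) (m / u) = deriv (deriv q1) (m / u) -
      (1 * deriv (hFun q1 q2) (m / u) +
        (1 * deriv (hFun q1 q2) (m / u) + m / u * deriv (deriv (hFun q1 q2)) (m / u))) := by
    rw [df.deriv_eq]
    exact (dd1.sub (((dh _ hcU).const_mul 1).add (hidm.mul ddh))).deriv
  have eu := ((dH.comp u ((hasDerivAt_const u m).div (hasDerivAt_id' u) hune)).div
    (hasDerivAt_id' u) hune).deriv
  have em := ((dH.comp m ((hasDerivAt_id' m).div_const u)).div_const u).deriv
  have eu' : deriv (fun u' => HFun q1 q2 (m / u') / u') u = _ := eu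
  have em' : deriv (fun m' => HFun q1 q2 (m' / u) / u) m = _ := em
  rw [eu', em', ddf]
  simp only [Function.comp, Pi.div_apply, HFun]
  generalize deriv (deriv q1) (m / u) = a
  generalize deriv (deriv (hFun q1 q2)) (m / u) = b
  generalize deriv (hFun q1 q2) (m / u) = p
  generalize deriv q1 (m / u) = q
  field_simp
  ring
end

section
/- Let G : ℝ → ℝ be C² with G > 0 and G'' > 0 on [0,1], and let α > 1 be a real number. Then the function E_α(u,m) = (u·G(m/u))^α is strictly convex on the open region {(u,m) ∈ ℝ² : u > 0 and 0 < m < u}. -/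
open Set

/-- If `G` is `C²` with `G > 0` and `G'' > 0` on `[0,1]` and `α > 1`, then
`E_α(u,m) = (u·G(m/u))^α` is strictly convex on the open region
`{(u,m) : u > 0, 0 < m < u}`. -/
theorem Ealpha_strictConvexOn
    (G : ℝ → ℝ) (hG : ContDiff ℝ 2 G)
    (hGpos : ∀ c ∈ Icc (0:ℝ) 1, 0 < G c)
    (hGsec : ∀ c ∈ Icc (0:ℝ) 1, 0 < deriv (deriv G) c)
    (α : ℝ) (hα : 1 < α) :
    StrictConvexOn ℝ {p : ℝ × ℝ | 0 < p.1 ∧ 0 < p.2 ∧ p.2 < p.1}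
      (fun p => (p.1 * G (p.2 / p.1)) ^ α) := by
  have hSC : StrictConvexOn ℝ (Icc (0:ℝ) 1) G := by
    apply strictConvexOn_of_deriv2_pos (convex_Icc 0 1) hG.continuous.continuousOn
    intro x hx
    exact hGsec x (interior_subset hx)
  have hP := strictConvexOn_rpow hα
  have hmem : ∀ u m : ℝ, 0 < u → 0 < m → m < u → m / u ∈ Icc (0:ℝ) 1 := by
    intro u m hu hm hmu
    exact ⟨by positivity, (div_le_one hu).2 hmu.le⟩
  constructor
  · rintro ⟨u, m⟩ ⟨h1, h2, h3⟩ ⟨v, n⟩ ⟨k1, k2, k3⟩ a b ha hb hab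
    simp only [mem_setOf_eq, Prod.smul_mk, Prod.mk_add_mk, smul_eq_mul] at *
    rcases ha.eq_or_lt with rfl | ha
    · have : b = 1 := by linarith
      subst this
      simp [k1, k2, k3]
    · refine ⟨by positivity, by positivity, ?_⟩
      nlinarith [mul_lt_mul_of_pos_left h3 ha, mul_le_mul_of_nonneg_left k3.le hb]
  · rintro ⟨u, m⟩ ⟨h1, h2, h3⟩ ⟨v, n⟩ ⟨k1, k2, k3⟩ hne a b ha hb hab
    simp only [Prod.smul_mk, Prod.mk_add_mk, smul_eq_mul] at *
    have hc := hmem u m h1 h2 h3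
    have hd := hmem v n k1 k2 k3
    have hm : m = u * (m / u) := by field_simp
    have hn : n = v * (n / v) := by field_simp
    generalize m / u = c at *
    generalize n / v = d at *
    subst hm hn
    have hU : 0 < a * u + b * v := by positivity
    have hs : 0 < a * u / (a * u + b * v) := by positivity
    have ht : 0 < b * v / (a * u + b * v) := by positivity
    have hst : a * u / (a * u + b * v) + b * v / (a * u + b * v) = 1 := by
      field_simp
    have hX : 0 < u * G c := mul_pos h1 (hGpos c hc)
    have hY : 0 < v * G d := mul_pos k1 (hGpos d hd)
    have heq : (a * (u * c) + b * (v * d)) / (a * u + b * v)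
        = a * u / (a * u + b * v) * c + b * v / (a * u + b * v) * d := by
      field_simp
    rw [heq]
    have hcv : a * u / (a * u + b * v) * c + b * v / (a * u + b * v) * d ∈ Icc (0:ℝ) 1 :=
      convex_Icc 0 1 hc hd hs.le ht.le hst
    have hW0 := mul_pos hU (hGpos _ hcv)
    have hR : (a * u + b * v) * (a * u / (a * u + b * v) * G c + b * v / (a * u + b * v) * G d)
        = a * (u * G c) + b * (v * G d) := by
      field_simp
    by_cases hcd : c = d
    · subst hcd
      have huv : u ≠ v := by
        rintro rfl
        exact hne rfl
      have hXY : u * G c ≠ v * G c := fun h => huv (mul_right_cancel₀ (hGpos c hc).ne' h)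
      have := hP.2 (mem_Ici.2 hX.le) (mem_Ici.2 hY.le) hXY ha hb hab
      simp only [smul_eq_mul] at this
      rw [← add_mul, hst, one_mul]
      convert this using 2
      ring
    · have h := hSC.2 hc hd hcd hs ht hst
      simp only [smul_eq_mul] at h
      have h' := mul_lt_mul_of_pos_left h hU
      rw [hR] at h'
      have h4 := Real.rpow_lt_rpow hW0.le h' (by linarith : 0 < α)
      have := hP.convexOn.2 (mem_Ici.2 hX.le) (mem_Ici.2 hY.le) ha.le hb.le hab
      simp only [smul_eq_mul] at this
      exact h4.trans_le this
end

section
/- Assume q1, q2 are C¹ on a neighborhood of [0,1] with q1' ≥ 0 and h' ≤ 0 on [0,1]. Then for all 0 ≤ c_+ < c_- ≤ 1 and every c with c_+ ≤ c ≤ c_-, one has α(c_+,c_-) + h(c_+) ≥ α(c_+,c_-) + h(c) ≥ α(c_+,c_-) + h(c_-) > 0, where α(c_+,c_-) = (f(c_+) − f(c_-))/(c_+ − c_-) + 1. -/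
open Set

/-- `α(c₊,c₋) = (f(c₊) - f(c₋))/(c₊ - c₋) + 1`. -/
noncomputable def alphaFun (q1 q2 : ℝ → ℝ) (a b : ℝ) : ℝ :=
  (fFun q1 q2 a - fFun q1 q2 b) / (a - b) + 1

/-- If `q1' ≥ 0` and `h' ≤ 0` on `[0,1]`, then for `0 ≤ c₊ < c₋ ≤ 1` and any
`c` between them, `α + h(c₊) ≥ α + h(c) ≥ α + h(c₋) > 0`. -/
theorem alpha_add_h_pos
    (q1 q2 : ℝ → ℝ)
    (hreg : ∃ U : Set ℝ, IsOpen U ∧ Icc (0:ℝ) 1 ⊆ U ∧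
      ContDiffOn ℝ 1 q1 U ∧ ContDiffOn ℝ 1 q2 U)
    (hq1' : ∀ c ∈ Icc (0:ℝ) 1, 0 ≤ deriv q1 c)
    (hh' : ∀ c ∈ Icc (0:ℝ) 1, deriv (hFun q1 q2) c ≤ 0)
    (cp cm : ℝ) (h0 : 0 ≤ cp) (hlt : cp < cm) (h1 : cm ≤ 1)
    (c : ℝ) (hc1 : cp ≤ c) (hc2 : c ≤ cm) :
    alphaFun q1 q2 cp cm + hFun q1 q2 c ≤ alphaFun q1 q2 cp cm + hFun q1 q2 cp ∧
    alphaFun q1 q2 cp cm + hFun q1 q2 cm ≤ alphaFun q1 q2 cp cm + hFun q1 q2 c ∧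
    0 < alphaFun q1 q2 cp cm + hFun q1 q2 cm := by
  obtain ⟨U, hU, hsub, hc1', hc2'⟩ := hreg
  have d1 : ∀ x ∈ Icc (0:ℝ) 1, DifferentiableAt ℝ q1 x := fun x hx =>
    (hc1'.differentiableOn one_ne_zero).differentiableAt (hU.mem_nhds (hsub hx))
  have d2 : ∀ x ∈ Icc (0:ℝ) 1, DifferentiableAt ℝ q2 x := fun x hx =>
    (hc2'.differentiableOn one_ne_zero).differentiableAt (hU.mem_nhds (hsub hx))
  have dh : ∀ x ∈ Icc (0:ℝ) 1, DifferentiableAt ℝ (hFun q1 q2) x := fun x hx =>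
    (d1 x hx).add (d2 x hx)
  have m1 : MonotoneOn q1 (Icc 0 1) :=
    monotoneOn_of_deriv_nonneg (convex_Icc 0 1)
      (fun x hx => (d1 x hx).continuousAt.continuousWithinAt)
      (fun x hx => (d1 x (interior_subset hx)).differentiableWithinAt)
      (fun x hx => hq1' x (interior_subset hx))
  have mh : AntitoneOn (hFun q1 q2) (Icc 0 1) :=
    antitoneOn_of_deriv_nonpos (convex_Icc 0 1)
      (fun x hx => (dh x hx).continuousAt.continuousWithinAt)
      (fun x hx => (dh x (interior_subset hx)).differentiableWithinAt)
      (fun x hx => hh' x (interior_subset hx))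
  have icp : cp ∈ Icc (0:ℝ) 1 := ⟨h0, by linarith⟩
  have icm : cm ∈ Icc (0:ℝ) 1 := ⟨by linarith, h1⟩
  have ic : c ∈ Icc (0:ℝ) 1 := ⟨by linarith, by linarith⟩
  have e1 := mh icp ic hc1
  have e2 := mh ic icm hc2
  have e3 := m1 icp icm hlt.le
  refine ⟨by linarith, by linarith, ?_⟩
  have key : alphaFun q1 q2 cp cm + hFun q1 q2 cm =
      1 + (q1 cm - q1 cp) / (cm - cp)
        + cp * (hFun q1 q2 cp - hFun q1 q2 cm) / (cm - cp) := by
    have n1 : cm - cp ≠ 0 := sub_ne_zero.mpr hlt.ne'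
    have n3 : cp - cm = -(cm - cp) := by ring
    unfold alphaFun fFun
    rw [n3, div_neg]
    field_simp
    ring
  rw [key]
  have p1 : 0 ≤ (q1 cm - q1 cp) / (cm - cp) :=
    div_nonneg (by linarith) (by linarith)
  have p2 : 0 ≤ cp * (hFun q1 q2 cp - hFun q1 q2 cm) / (cm - cp) :=
    div_nonneg (mul_nonneg h0 (by linarith)) (by linarith)
  linarith
end

section
/- Assume q1, q2 are C² on a neighborhood of [0,1] with q1' ≥ 0, h' ≤ 0, and f convex on [0,1]. Then for all 0 ≤ c_+ < c_- ≤ 1, the partial derivative of S with respect to its first argument satisfies ∂S/∂c_+(c_+,c_-) ≤ 0. (The quantities α(c_+,c_-) + h(c_±) are positive, so S is well defined and differentiable there.) -/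
open Set

/-- `S(c₊,c₋) = log((α + h(c₊))/(α + h(c₋)))`, the jump of `log u` across a shock. -/
noncomputable def SFun (q1 q2 : ℝ → ℝ) (a b : ℝ) : ℝ :=
  Real.log ((alphaFun q1 q2 a b + hFun q1 q2 a) / (alphaFun q1 q2 a b + hFun q1 q2 b))

/-- If `q1' ≥ 0`, `h' ≤ 0` and `f` is convex on `[0,1]`, then
`∂S/∂c₊(c₊,c₋) ≤ 0` for all `0 ≤ c₊ < c₋ ≤ 1`. -/
theorem shock_deriv_first_arg_nonpos
    (q1 q2 : ℝ → ℝ)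
    (hreg : ∃ U : Set ℝ, IsOpen U ∧ Icc (0:ℝ) 1 ⊆ U ∧
      ContDiffOn ℝ 2 q1 U ∧ ContDiffOn ℝ 2 q2 U)
    (hq1' : ∀ c ∈ Icc (0:ℝ) 1, 0 ≤ deriv q1 c)
    (hh' : ∀ c ∈ Icc (0:ℝ) 1, deriv (hFun q1 q2) c ≤ 0)
    (hfconv : ConvexOn ℝ (Icc (0:ℝ) 1) (fFun q1 q2))
    (cp cm : ℝ) (h0 : 0 ≤ cp) (hlt : cp < cm) (h1 : cm ≤ 1) :
    deriv (fun a => SFun q1 q2 a cm) cp ≤ 0 := by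
  obtain ⟨U, hU, hsub, hc1, hc2⟩ := hreg
  have d1 : ∀ c ∈ Icc (0:ℝ) 1, DifferentiableAt ℝ q1 c := fun c hc =>
    ((hc1.contDiffAt (hU.mem_nhds (hsub hc))).differentiableAt (by norm_num))
  have d2 : ∀ c ∈ Icc (0:ℝ) 1, DifferentiableAt ℝ q2 c := fun c hc =>
    ((hc2.contDiffAt (hU.mem_nhds (hsub hc))).differentiableAt (by norm_num))
  have dh : ∀ c ∈ Icc (0:ℝ) 1, DifferentiableAt ℝ (hFun q1 q2) c := fun c hc =>
    (d1 c hc).add (d2 c hc)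
  have ha : cp ∈ Icc (0:ℝ) 1 := ⟨h0, by linarith⟩
  have hb : cm ∈ Icc (0:ℝ) 1 := ⟨by linarith, h1⟩
  have m1 : MonotoneOn q1 (Icc (0:ℝ) 1) :=
    monotoneOn_of_deriv_nonneg (convex_Icc 0 1)
      (fun c hc => (d1 c hc).continuousAt.continuousWithinAt)
      (fun c hc => (d1 c (interior_subset hc)).differentiableWithinAt)
      (fun c hc => hq1' c (interior_subset hc))
  have m2 : AntitoneOn (hFun q1 q2) (Icc (0:ℝ) 1) :=
    antitoneOn_of_deriv_nonpos (convex_Icc 0 1)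
      (fun c hc => (dh c hc).continuousAt.continuousWithinAt)
      (fun c hc => (dh c (interior_subset hc)).differentiableWithinAt)
      (fun c hc => hh' c (interior_subset hc))
  have e1 := m1 ha hb hlt.le
  have e2 := m2 ha hb hlt.le
  have hpos : 0 < cm - cp := by linarith
  have hne : cp - cm ≠ 0 := by linarith
  have hQ : 0 < alphaFun q1 q2 cp cm + hFun q1 q2 cm := by
    have : alphaFun q1 q2 cp cm + hFun q1 q2 cm
        = 1 + (q1 cm - q1 cp) / (cm - cp)
          + cp * (hFun q1 q2 cp - hFun q1 q2 cm) / (cm - cp) := by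
      unfold alphaFun fFun
      have := hpos.ne'
      rw [show cp - cm = -(cm - cp) by ring, div_neg]
      field_simp
      ring
    rw [this]
    have := div_nonneg (sub_nonneg.2 e1) hpos.le
    have := div_nonneg (mul_nonneg h0 (sub_nonneg.2 e2)) hpos.le
    linarith
  have hPQ : alphaFun q1 q2 cp cm + hFun q1 q2 cm ≤ alphaFun q1 q2 cp cm + hFun q1 q2 cp := by
    linarith
  have hP := lt_of_lt_of_le hQ hPQ
  have hdf : DifferentiableAt ℝ (fFun q1 q2) cp :=
    (d1 cp ha).sub (differentiableAt_id.mul (dh cp ha))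
  have hsl := hfconv.le_slope_of_hasDerivAt ha hb hlt hdf.hasDerivAt
  rw [slope_def_field, le_div_iff₀ hpos] at hsl
  have hA : HasDerivAt (fun a => alphaFun q1 q2 a cm)
      ((deriv (fFun q1 q2) cp * (cp - cm) - (fFun q1 q2 cp - fFun q1 q2 cm) * 1) / (cp - cm) ^ 2)
      cp :=
    ((hdf.hasDerivAt.sub_const _).div ((hasDerivAt_id cp).sub_const cm) hne).add_const 1
  have hA0 : 0 ≤ (deriv (fFun q1 q2) cp * (cp - cm) - (fFun q1 q2 cp - fFun q1 q2 cm) * 1)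
      / (cp - cm) ^ 2 := div_nonneg (by linarith) (sq_nonneg _)
  generalize (deriv (fFun q1 q2) cp * (cp - cm) - (fFun q1 q2 cp - fFun q1 q2 cm) * 1)
      / (cp - cm) ^ 2 = A at hA hA0
  have hN := hA.add (dh cp ha).hasDerivAt
  have hD := hA.add_const (hFun q1 q2 cm)
  have hS := (hN.div hD hQ.ne').log (div_pos hP hQ).ne'
  have hS' : HasDerivAt (fun a => SFun q1 q2 a cm) _ cp := hS
  rw [hS'.deriv]
  have hh := hh' cp ha
  refine div_nonpos_of_nonpos_of_nonneg (div_nonpos_of_nonpos_of_nonneg ?_ (sq_nonneg _))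
    (div_pos hP hQ).le
  simp only [Pi.add_apply]
  nlinarith [mul_nonneg hA0 (sub_nonneg.2 e2), mul_nonneg (neg_nonneg.2 hh) hQ.le]
end

section
/- Assume q1 ≡ 0 (the first gas is inert) and q2 is C² on a neighborhood of [0,1] with q2' ≤ 0 and q2'' ≤ 0 on [0,1] (so h = q2 and f(c) = −c·q2(c)). Then for all 0 ≤ c_+ < c_- ≤ 1, the partial derivative of S with respect to its second argument satisfies ∂S/∂c_-(c_+,c_-) ≥ 0. -/
open Set

/-- Inert first gas (`q1 ≡ 0`): if `q2' ≤ 0` and `q2'' ≤ 0` on `[0,1]`, then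
`∂S/∂c₋(c₊,c₋) ≥ 0` for all `0 ≤ c₊ < c₋ ≤ 1`. -/
theorem shock_deriv_second_arg_nonneg_inert
    (q2 : ℝ → ℝ)
    (hreg : ∃ U : Set ℝ, IsOpen U ∧ Icc (0:ℝ) 1 ⊆ U ∧ ContDiffOn ℝ 2 q2 U)
    (hq2' : ∀ c ∈ Icc (0:ℝ) 1, deriv q2 c ≤ 0)
    (hq2'' : ∀ c ∈ Icc (0:ℝ) 1, deriv (deriv q2) c ≤ 0)
    (cp cm : ℝ) (h0 : 0 ≤ cp) (hlt : cp < cm) (h1 : cm ≤ 1) :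
    0 ≤ deriv (fun b => SFun (fun _ => 0) q2 cp b) cm := by
  obtain ⟨U, hUo, hU, hq⟩ := hreg
  have hcd : ∀ c ∈ Icc (0:ℝ) 1, ContDiffAt ℝ 2 q2 c := fun c hc =>
    hq.contDiffAt (hUo.mem_nhds (hU hc))
  have hd : ∀ c ∈ Icc (0:ℝ) 1, DifferentiableAt ℝ q2 c := fun c hc =>
    (hcd c hc).differentiableAt (by norm_num)
  have hdd : ∀ c ∈ Icc (0:ℝ) 1, DifferentiableAt ℝ (deriv q2) c := fun c hc => by
    have h2 : ContDiffOn ℝ 1 (deriv q2) U := hq.deriv_of_isOpen hUo (by norm_num)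
    exact (h2.contDiffAt (hUo.mem_nhds (hU hc))).differentiableAt (by norm_num)
  have hanti : AntitoneOn (deriv q2) (Icc (0:ℝ) 1) := by
    apply antitoneOn_of_deriv_nonpos (convex_Icc 0 1)
    · exact fun c hc => (hdd c hc).continuousAt.continuousWithinAt
    · exact fun c hc => (hdd c (interior_subset hc)).differentiableWithinAt
    · exact fun c hc => hq2'' c (interior_subset hc)
  have hcm : cm ∈ Icc (0:ℝ) 1 := ⟨by linarith, h1⟩
  obtain ⟨ξ, hξ, hξm⟩ := exists_deriv_eq_slope q2 hlt
    (fun c hc => (hd c ⟨by linarith [hc.1], by linarith [hc.2]⟩).continuousAt.continuousWithinAt)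
    (fun c hc => (hd c ⟨by linarith [hc.1], by linarith [hc.2]⟩).differentiableWithinAt)
  have hξI : ξ ∈ Icc (0:ℝ) 1 := ⟨by linarith [hξ.1], by linarith [hξ.2]⟩
  have hle : deriv q2 cm ≤ deriv q2 ξ := hanti hξI hcm hξ.2.le
  have hm0 : deriv q2 ξ ≤ 0 := hq2' ξ hξI
  have hpos : 0 < cm - cp := by linarith
  have hev : (fun b => SFun (fun _ => 0) q2 cp b) =ᶠ[nhds cm]
      (fun b => Real.log ((1 - b * ((q2 b - q2 cp) / (b - cp))) /
        (1 - cp * ((q2 b - q2 cp) / (b - cp))))) := by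
    filter_upwards [lt_mem_nhds hlt] with b hb
    have hb1 : b - cp ≠ 0 := (sub_pos.2 hb).ne'
    have hb2 : cp - b ≠ 0 := (sub_neg.2 hb).ne
    simp only [SFun, alphaFun, fFun, hFun]
    congr 2
    · rw [← neg_sub b cp]; field_simp; ring
    · rw [← neg_sub b cp]; field_simp; ring
  rw [hev.deriv_eq]
  set m := deriv q2 ξ with hm
  have hM : HasDerivAt (fun b => (q2 b - q2 cp) / (b - cp))
      ((deriv q2 cm - m) / (cm - cp)) cm := by
    have := (((hd cm hcm).hasDerivAt.sub_const (q2 cp)).div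
      ((hasDerivAt_id cm).sub_const cp) hpos.ne')
    refine this.congr_deriv ?_
    rw [hξm]; simp only [id]; field_simp
  set m' := (deriv q2 cm - m) / (cm - cp) with hm'
  have hm'0 : m' ≤ 0 := div_nonpos_of_nonpos_of_nonneg (by linarith) hpos.le
  have hA : 0 < 1 - cm * m := by nlinarith
  have hB : 0 < 1 - cp * m := by nlinarith
  have hN : HasDerivAt (fun b => 1 - b * ((q2 b - q2 cp) / (b - cp)))
      (-(1 * m + cm * m')) cm := by
    have := ((hasDerivAt_id cm).mul hM).const_sub 1
    rw [hξm]; exact this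
  have hD : HasDerivAt (fun b => 1 - cp * ((q2 b - q2 cp) / (b - cp)))
      (-(cp * m')) cm := (hM.const_mul cp).const_sub 1
  have hL := (hN.div hD (by rw [← hξm]; exact hB.ne')).log
    (by simp only [Pi.div_apply]; rw [← hξm]; exact (div_pos hA hB).ne')
  have hL' := hL.deriv
  simp only [Pi.div_apply] at hL'
  rw [hL', ← hξm]
  apply div_nonneg _ (div_pos hA hB).le
  apply div_nonneg _ (sq_nonneg _)
  nlinarith [mul_nonneg (neg_nonneg.2 hm0) hB.le, mul_nonneg hpos.le (neg_nonneg.2 hm'0)]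
end

section
/- Assume q1, q2 are C² on a neighborhood of [0,1] with q1' ≥ 0, q2' ≤ 0, q1'' ≤ 0, q2'' ≥ 0, h' ≤ 0, and f convex on [0,1]. Then for all 0 ≤ c_+ < c_- ≤ 1, the partial derivative of S with respect to its second argument satisfies ∂S/∂c_-(c_+,c_-) ≥ 0. -/
open Set

/-- Two active gases: if `q1' ≥ 0`, `q2' ≤ 0`, `q1'' ≤ 0`, `q2'' ≥ 0`, `h' ≤ 0`
and `f` is convex on `[0,1]`, then `∂S/∂c₋(c₊,c₋) ≥ 0` for all `0 ≤ c₊ < c₋ ≤ 1`. -/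
theorem shock_deriv_second_arg_nonneg
    (q1 q2 : ℝ → ℝ)
    (hreg : ∃ U : Set ℝ, IsOpen U ∧ Icc (0:ℝ) 1 ⊆ U ∧
      ContDiffOn ℝ 2 q1 U ∧ ContDiffOn ℝ 2 q2 U)
    (hq1' : ∀ c ∈ Icc (0:ℝ) 1, 0 ≤ deriv q1 c)
    (hq2' : ∀ c ∈ Icc (0:ℝ) 1, deriv q2 c ≤ 0)
    (hq1'' : ∀ c ∈ Icc (0:ℝ) 1, deriv (deriv q1) c ≤ 0)
    (hq2'' : ∀ c ∈ Icc (0:ℝ) 1, 0 ≤ deriv (deriv q2) c)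
    (hh' : ∀ c ∈ Icc (0:ℝ) 1, deriv (hFun q1 q2) c ≤ 0)
    (hfconv : ConvexOn ℝ (Icc (0:ℝ) 1) (fFun q1 q2))
    (cp cm : ℝ) (h0 : 0 ≤ cp) (hlt : cp < cm) (h1 : cm ≤ 1) :
    0 ≤ deriv (fun b => SFun q1 q2 cp b) cm := by
  obtain ⟨U, hU, hsub, hc1, hc2⟩ := hreg
  have hd1 : ∀ c ∈ Icc (0:ℝ) 1, DifferentiableAt ℝ q1 c := fun c hc =>
    (hc1.differentiableOn (by norm_num)).differentiableAt (hU.mem_nhds (hsub hc))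
  have hd2 : ∀ c ∈ Icc (0:ℝ) 1, DifferentiableAt ℝ q2 c := fun c hc =>
    (hc2.differentiableOn (by norm_num)).differentiableAt (hU.mem_nhds (hsub hc))
  have hdd1 : ∀ c ∈ Icc (0:ℝ) 1, DifferentiableAt ℝ (deriv q1) c := fun c hc =>
    (((contDiffOn_succ_iff_deriv_of_isOpen (n := 1) hU).1 hc1).2.2.differentiableOn
      (by norm_num)).differentiableAt (hU.mem_nhds (hsub hc))
  have hcp : cp ∈ Icc (0:ℝ) 1 := ⟨h0, by linarith⟩
  have hcm : cm ∈ Icc (0:ℝ) 1 := ⟨by linarith, h1⟩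
  have anti : AntitoneOn (deriv q1) (Icc (0:ℝ) 1) :=
    antitoneOn_of_deriv_nonpos (convex_Icc 0 1)
      (fun c hc => (hdd1 c hc).continuousAt.continuousWithinAt)
      (fun c hc => (hdd1 c (interior_subset hc)).differentiableWithinAt)
      (fun c hc => hq1'' c (interior_subset hc))
  have m1 : q1 cp ≤ q1 cm :=
    monotoneOn_of_deriv_nonneg (convex_Icc 0 1)
      (fun c hc => (hd1 c hc).continuousAt.continuousWithinAt)
      (fun c hc => (hd1 c (interior_subset hc)).differentiableWithinAt)
      (fun c hc => hq1' c (interior_subset hc)) hcp hcm hlt.le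
  have m2 : q2 cm ≤ q2 cp :=
    antitoneOn_of_deriv_nonpos (convex_Icc 0 1)
      (fun c hc => (hd2 c hc).continuousAt.continuousWithinAt)
      (fun c hc => (hd2 c (interior_subset hc)).differentiableWithinAt)
      (fun c hc => hq2' c (interior_subset hc)) hcp hcm hlt.le
  have hdh : ∀ c ∈ Icc (0:ℝ) 1, DifferentiableAt ℝ (hFun q1 q2) c := fun c hc =>
    (hd1 c hc).add (hd2 c hc)
  have mh : hFun q1 q2 cm ≤ hFun q1 q2 cp :=
    antitoneOn_of_deriv_nonpos (convex_Icc 0 1)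
      (fun c hc => (hdh c hc).continuousAt.continuousWithinAt)
      (fun c hc => (hdh c (interior_subset hc)).differentiableWithinAt)
      (fun c hc => hh' c (interior_subset hc)) hcp hcm hlt.le
  have hconc : (cm - cp) * deriv q1 cm ≤ q1 cm - q1 cp := by
    obtain ⟨ξ, hξ, he⟩ := exists_deriv_eq_slope q1 hlt
      (fun c hc => (hd1 c ⟨by linarith [hc.1], by linarith [hc.2]⟩).continuousAt.continuousWithinAt)
      (fun c hc => (hd1 c ⟨by linarith [hc.1], by linarith [hc.2]⟩).differentiableWithinAt)
    have := anti (a := ξ) ⟨by linarith [hξ.1], by linarith [hξ.2]⟩ hcm hξ.2.le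
    rw [he, le_div_iff₀ (by linarith)] at this
    linarith
  have D1 := (hd1 cm hcm).hasDerivAt
  have DH := (hdh cm hcm).hasDerivAt
  have hhm := hh' cm hcm
  have DF : HasDerivAt (fFun q1 q2)
      (deriv q1 cm - (1 * hFun q1 q2 cm + cm * deriv (hFun q1 q2) cm)) cm :=
    D1.sub ((hasDerivAt_id cm).mul DH)
  have hne : cp - cm ≠ 0 := by linarith
  have hΔ : 0 < cm - cp := by linarith
  have DA := ((DF.const_sub (fFun q1 q2 cp)).div ((hasDerivAt_id cm).const_sub cp) hne).add_const 1
  have eA : alphaFun q1 q2 cp cm + hFun q1 q2 cp =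
      1 + ((q1 cm - q1 cp) * (1 - cm) + cm * (q2 cp - q2 cm)) / (cm - cp) := by
    have := hΔ.ne'
    rw [alphaFun, ← neg_sub cm cp]
    simp only [fFun, hFun]
    field_simp
    ring
  have eB : alphaFun q1 q2 cp cm + hFun q1 q2 cm =
      1 + ((q1 cm - q1 cp) * (1 - cp) + cp * (q2 cp - q2 cm)) / (cm - cp) := by
    have := hΔ.ne'
    rw [alphaFun, ← neg_sub cm cp]
    simp only [fFun, hFun]
    field_simp
    ring
  have pA : 0 < alphaFun q1 q2 cp cm + hFun q1 q2 cp := by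
    rw [eA]
    have : 0 ≤ (q1 cm - q1 cp) * (1 - cm) + cm * (q2 cp - q2 cm) :=
      add_nonneg (mul_nonneg (by linarith) (by linarith)) (mul_nonneg hcm.1 (by linarith))
    positivity
  have pB : 0 < alphaFun q1 q2 cp cm + hFun q1 q2 cm := by
    rw [eB]
    have : 0 ≤ (q1 cm - q1 cp) * (1 - cp) + cp * (q2 cp - q2 cm) :=
      add_nonneg (mul_nonneg (by linarith) (by linarith)) (mul_nonneg h0 (by linarith))
    positivity
  obtain ⟨A', hA'⟩ : ∃ x, x = ((-(deriv q1 cm - (1 * hFun q1 q2 cm + cm * deriv (hFun q1 q2) cm)))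
      * (cp - cm) - (fFun q1 q2 cp - fFun q1 q2 cm) * (-1)) / (cp - cm) ^ 2 := ⟨_, rfl⟩
  have DA2 : HasDerivAt (fun b => alphaFun q1 q2 cp b) A' cm := by
    rw [hA']; exact DA
  have DS : HasDerivAt (fun b => SFun q1 q2 cp b) _ cm :=
    ((DA2.add_const (hFun q1 q2 cp)).div (DA2.add DH) pB.ne').log (div_pos pA pB).ne'
  rw [DS.deriv]
  refine div_nonneg (div_nonneg ?_ (sq_nonneg _)) (div_pos pA pB).le
  simp only [Pi.add_apply]
  have key : A' * (alphaFun q1 q2 cp cm + hFun q1 q2 cm) -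
      (alphaFun q1 q2 cp cm + hFun q1 q2 cp) * (A' + deriv (hFun q1 q2) cm) =
      ((hFun q1 q2 cp - hFun q1 q2 cm) * (q1 cm - q1 cp - (cm - cp) * deriv q1 cm)
        + cp * (hFun q1 q2 cm - hFun q1 q2 cp) ^ 2
        + (cm - cp) * (-deriv (hFun q1 q2) cm) * (cm - cp + (q1 cm - q1 cp))) / (cm - cp) ^ 2 := by
    have := hΔ.ne'
    rw [hA', alphaFun, ← neg_sub cm cp]
    simp only [fFun]
    field_simp
    ring
  rw [key]
  have t1 := mul_nonneg (sub_nonneg.2 mh) (sub_nonneg.2 hconc)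
  have t2 := mul_nonneg h0 (sq_nonneg (hFun q1 q2 cm - hFun q1 q2 cp))
  have t3 := mul_nonneg (mul_nonneg hΔ.le (neg_nonneg.2 hhm))
    (add_nonneg hΔ.le (sub_nonneg.2 m1))
  exact div_nonneg (add_nonneg (add_nonneg t1 t2) t3) (sq_nonneg _)
end

section
/- Let K1, K2 be constants with 0 ≤ K1 ≤ K2, and take the linear isotherms q1(c) = K1·c and q2(c) = K2·(1 − c). Then f''(c) = 2(K2 − K1) ≥ 0 and h'(c) = K1 − K2 ≤ 0 for all c ∈ [0,1], and for all 0 ≤ c_+ < c_- ≤ 1 the shock function satisfies ∂S/∂c_-(c_+,c_-) ≥ 0 ≥ ∂S/∂c_+(c_+,c_-). -/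
open Set

lemma SFun_linear (K1 K2 a b : ℝ) (hab : a ≠ b) :
    SFun (fun c => K1 * c) (fun c => K2 * (1 - c)) a b
      = Real.log ((1 + K1 + (K2 - K1) * b) / (1 + K1 + (K2 - K1) * a)) := by
  have h : a - b ≠ 0 := sub_ne_zero.mpr hab
  have hα : alphaFun (fun c => K1 * c) (fun c => K2 * (1 - c)) a b
      = 1 - (K2 - K1) + (K2 - K1) * (a + b) := by
    unfold alphaFun fFun hFun
    field_simp
    ring
  unfold SFun
  rw [hα]
  unfold hFun
  congr 2 <;> ring

/-- Linear isotherms `q1(c) = K1·c`, `q2(c) = K2·(1-c)` with `0 ≤ K1 ≤ K2`: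
`f'' = 2(K2 - K1) ≥ 0`, `h' = K1 - K2 ≤ 0`, and the shock curves are
monotonous: `∂S/∂c₋ ≥ 0 ≥ ∂S/∂c₊`. -/
theorem linear_isotherms_assumptions
    (K1 K2 : ℝ) (hK1 : 0 ≤ K1) (hK : K1 ≤ K2) :
    (∀ c ∈ Icc (0:ℝ) 1,
        deriv (deriv (fFun (fun c => K1 * c) (fun c => K2 * (1 - c)))) c
          = 2 * (K2 - K1) ∧
        0 ≤ deriv (deriv (fFun (fun c => K1 * c) (fun c => K2 * (1 - c)))) c ∧
        deriv (hFun (fun c => K1 * c) (fun c => K2 * (1 - c))) c = K1 - K2 ∧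
        deriv (hFun (fun c => K1 * c) (fun c => K2 * (1 - c))) c ≤ 0) ∧
    (∀ cp cm : ℝ, 0 ≤ cp → cp < cm → cm ≤ 1 →
        0 ≤ deriv (fun b => SFun (fun c => K1 * c) (fun c => K2 * (1 - c)) cp b) cm ∧
        deriv (fun a => SFun (fun c => K1 * c) (fun c => K2 * (1 - c)) a cm) cp ≤ 0) := by
  have hD : 0 ≤ K2 - K1 := sub_nonneg.mpr hK
  have hh : ∀ c, deriv (hFun (fun c => K1 * c) (fun c => K2 * (1 - c))) c = K1 - K2 := by
    intro c
    have e : hFun (fun c => K1 * c) (fun c => K2 * (1 - c))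
        = fun c => (K1 - K2) * c + K2 := by
      funext x; unfold hFun; ring
    rw [e]
    have := ((hasDerivAt_id' c).const_mul (K1 - K2)).add_const K2
    simpa using this.deriv
  have hf : ∀ c, deriv (deriv (fFun (fun c => K1 * c) (fun c => K2 * (1 - c)))) c
      = 2 * (K2 - K1) := by
    intro c
    have e : fFun (fun c => K1 * c) (fun c => K2 * (1 - c))
        = fun c => (K2 - K1) * (c * c - c) := by
      funext x; unfold fFun hFun; ring
    have e2 : deriv (fun c : ℝ => (K2 - K1) * (c * c - c))
        = fun c => 2 * (K2 - K1) * c + (-(K2 - K1)) := by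
      funext x
      have := ((((hasDerivAt_id' x).mul (hasDerivAt_id' x)).sub
        (hasDerivAt_id' x)).const_mul (K2 - K1)).deriv
      refine Eq.trans this ?_
      ring
    rw [e, e2]
    have := ((hasDerivAt_id' c).const_mul (2 * (K2 - K1))).add_const (-(K2 - K1))
    simpa using this.deriv
  have lin : ∀ x : ℝ, HasDerivAt (fun x : ℝ => 1 + K1 + (K2 - K1) * x) (K2 - K1) x := by
    intro x
    simpa using ((hasDerivAt_id' x).const_mul (K2 - K1)).const_add (1 + K1)
  refine ⟨fun c _ => ⟨hf c, ?_, hh c, ?_⟩, fun cp cm h0 hlt h1 => ?_⟩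
  · rw [hf]; linarith
  · rw [hh]; linarith
  have hp : 0 < 1 + K1 + (K2 - K1) * cp := by
    have := mul_nonneg hD h0
    linarith
  have hm : 0 < 1 + K1 + (K2 - K1) * cm := by
    have := mul_nonneg hD (h0.trans hlt.le)
    linarith
  constructor
  · have ev : (fun b => SFun (fun c => K1 * c) (fun c => K2 * (1 - c)) cp b)
        =ᶠ[nhds cm] fun b => Real.log ((1 + K1 + (K2 - K1) * b) / (1 + K1 + (K2 - K1) * cp)) := by
      filter_upwards [lt_mem_nhds hlt] with b hb
      exact SFun_linear K1 K2 cp b hb.ne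
    rw [ev.deriv_eq, (((lin cm).div_const _).log (div_pos hm hp).ne').deriv]
    positivity
  · have ev : (fun a => SFun (fun c => K1 * c) (fun c => K2 * (1 - c)) a cm)
        =ᶠ[nhds cp] fun a => Real.log ((1 + K1 + (K2 - K1) * cm) / (1 + K1 + (K2 - K1) * a)) := by
      filter_upwards [gt_mem_nhds hlt] with a ha
      exact SFun_linear K1 K2 a cm ha.ne
    rw [ev.deriv_eq, (((hasDerivAt_const cp (1 + K1 + (K2 - K1) * cm)).fun_div (lin cp) hp.ne').log
      (div_pos hm hp).ne').deriv]
    apply div_nonpos_of_nonpos_of_nonneg _ (div_pos hm hp).le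
    apply div_nonpos_of_nonpos_of_nonneg _ (sq_nonneg _)
    have := mul_nonneg hm.le hD
    linarith
end

section
/- Let Q1, Q2, K1, K2 > 0 with K1 ≥ K2 and Q1·K1 < Q2·K2, and take the binary Langmuir isotherms q1(c) = Q1·K1·c/D(c) and q2(c) = Q2·K2·(1 − c)/D(c), where D(c) = 1 + K1·c + K2·(1 − c). Then for all c ∈ [0,1]: f''(c) = 2(Q2·K2 − Q1·K1)(1 + K1)(1 + K2)/D(c)³ > 0, h'(c) ≤ 0, q1''(c) ≤ 0 ≤ q2''(c), and for all 0 ≤ c_+ < c_- ≤ 1 the shock function satisfies ∂S/∂c_-(c_+,c_-) ≥ 0 ≥ ∂S/∂c_+(c_+,c_-). Moreover, for arbitrary Q1, Q2, K1, K2 > 0 the function f'' never vanishes on [0,1] (the eigenvalue λ is genuinely nonlinear) if and only if Q1·K1 ≠ Q2·K2. -/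
open Set

/-- `D(c) = 1 + K1·c + K2·(1-c)`. -/
noncomputable def langD (K1 K2 c : ℝ) : ℝ := 1 + K1 * c + K2 * (1 - c)

/-- Binary Langmuir isotherm of the first gas. -/
noncomputable def langQ1 (Q1 K1 K2 : ℝ) : ℝ → ℝ := fun c => Q1 * K1 * c / langD K1 K2 c

/-- Binary Langmuir isotherm of the second gas. -/
noncomputable def langQ2 (Q2 K1 K2 : ℝ) : ℝ → ℝ :=
  fun c => Q2 * K2 * (1 - c) / langD K1 K2 c

lemma langD_pos {K1 K2 c : ℝ} (h1 : 0 < K1) (h2 : 0 < K2) (hc : c ∈ Icc (0:ℝ) 1) :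
    0 < langD K1 K2 c := by
  have a1 := mul_nonneg h1.le hc.1
  have a2 := mul_nonneg h2.le (sub_nonneg.2 hc.2)
  unfold langD
  linarith

lemma langD_hasDerivAt (K1 K2 c : ℝ) : HasDerivAt (langD K1 K2) (K1 - K2) c := by
  have h := (((hasDerivAt_id c).const_mul K1).const_add 1).add
    (((hasDerivAt_id c).const_sub 1).const_mul K2)
  refine HasDerivAt.congr_deriv (show HasDerivAt _ _ c from h) ?_
  ring

lemma langD_ev {K1 K2 c : ℝ} (h : langD K1 K2 c ≠ 0) :
    ∀ᶠ x in nhds c, langD K1 K2 x ≠ 0 :=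
  (langD_hasDerivAt K1 K2 c).continuousAt.eventually_ne h

lemma langQ1_hasDerivAt (Q K1 K2 : ℝ) {c : ℝ} (h : langD K1 K2 c ≠ 0) :
    HasDerivAt (langQ1 Q K1 K2) (Q * K1 * (1 + K2) / langD K1 K2 c ^ 2) c := by
  have h' := ((hasDerivAt_id c).const_mul (Q * K1)).div (langD_hasDerivAt K1 K2 c) h
  refine HasDerivAt.congr_deriv (show HasDerivAt _ _ c from h') ?_
  congr 1
  simp only [langD, id]
  ring

lemma langQ2_hasDerivAt (Q K1 K2 : ℝ) {c : ℝ} (h : langD K1 K2 c ≠ 0) :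
    HasDerivAt (langQ2 Q K1 K2) (-(Q * K2 * (1 + K1)) / langD K1 K2 c ^ 2) c := by
  have h' := (((hasDerivAt_id c).const_sub 1).const_mul (Q * K2)).div (langD_hasDerivAt K1 K2 c) h
  refine HasDerivAt.congr_deriv (show HasDerivAt _ _ c from h') ?_
  congr 1
  simp only [langD, id]
  ring

lemma quot_hasDerivAt (A K1 K2 : ℝ) {c : ℝ} (h : langD K1 K2 c ≠ 0) :
    HasDerivAt (fun x => A / langD K1 K2 x ^ 2) (-2 * A * (K1 - K2) / langD K1 K2 c ^ 3) c := by
  have h' := (hasDerivAt_const c A).div ((langD_hasDerivAt K1 K2 c).pow 2) (pow_ne_zero 2 h)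
  refine HasDerivAt.congr_deriv (show HasDerivAt _ _ c from h') ?_
  simp only [Pi.pow_apply]
  field_simp
  ring

lemma langQ1_deriv2 (Q K1 K2 : ℝ) {c : ℝ} (h : langD K1 K2 c ≠ 0) :
    deriv (deriv (langQ1 Q K1 K2)) c
      = -2 * (Q * K1 * (1 + K2)) * (K1 - K2) / langD K1 K2 c ^ 3 := by
  rw [← (quot_hasDerivAt (Q * K1 * (1 + K2)) K1 K2 h).deriv]
  apply Filter.EventuallyEq.deriv_eq
  filter_upwards [langD_ev h] with x hx
  exact (langQ1_hasDerivAt Q K1 K2 hx).deriv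

lemma langQ2_deriv2 (Q K1 K2 : ℝ) {c : ℝ} (h : langD K1 K2 c ≠ 0) :
    deriv (deriv (langQ2 Q K1 K2)) c
      = -2 * (-(Q * K2 * (1 + K1))) * (K1 - K2) / langD K1 K2 c ^ 3 := by
  rw [← (quot_hasDerivAt (-(Q * K2 * (1 + K1))) K1 K2 h).deriv]
  apply Filter.EventuallyEq.deriv_eq
  filter_upwards [langD_ev h] with x hx
  exact (langQ2_hasDerivAt Q K1 K2 hx).deriv

lemma f_hasDerivAt (Q1 Q2 K1 K2 : ℝ) {c : ℝ} (h : langD K1 K2 c ≠ 0) :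
    HasDerivAt (fFun (langQ1 Q1 K1 K2) (langQ2 Q2 K1 K2))
      ((Q1 * K1 - Q2 * K2) * ((1 + K2) - 2 * (1 + K2) * c - (K1 - K2) * c ^ 2)
        / langD K1 K2 c ^ 2) c := by
  have h1 := langQ1_hasDerivAt Q1 K1 K2 h
  have h2 := langQ2_hasDerivAt Q2 K1 K2 h
  have h' := h1.sub ((hasDerivAt_id c).mul (h1.add h2))
  refine HasDerivAt.congr_deriv (show HasDerivAt _ _ c from h') ?_
  simp only [Pi.add_apply, langQ1, langQ2, id]
  field_simp
  simp only [langD]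
  ring

lemma f_deriv2 (Q1 Q2 K1 K2 : ℝ) {c : ℝ} (h : langD K1 K2 c ≠ 0) :
    deriv (deriv (fFun (langQ1 Q1 K1 K2) (langQ2 Q2 K1 K2))) c
      = 2 * (Q2 * K2 - Q1 * K1) * (1 + K1) * (1 + K2) / (langD K1 K2 c) ^ 3 := by
  have key : HasDerivAt (fun x => (Q1 * K1 - Q2 * K2) *
      ((1 + K2) - 2 * (1 + K2) * x - (K1 - K2) * x ^ 2) / langD K1 K2 x ^ 2)
      (2 * (Q2 * K2 - Q1 * K1) * (1 + K1) * (1 + K2) / (langD K1 K2 c) ^ 3) c := by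
    have h' := ((((((hasDerivAt_id c).const_mul (2 * (1 + K2))).const_sub (1 + K2)).sub
      (((hasDerivAt_id c).pow 2).const_mul (K1 - K2))).const_mul (Q1 * K1 - Q2 * K2))).div
      ((langD_hasDerivAt K1 K2 c).pow 2) (pow_ne_zero 2 h)
    refine HasDerivAt.congr_deriv (show HasDerivAt _ _ c from h') ?_
    simp only [Pi.pow_apply, Pi.sub_apply, id]
    field_simp
    simp only [langD]
    ring
  rw [← key.deriv]
  apply Filter.EventuallyEq.deriv_eq
  filter_upwards [langD_ev h] with x hx
  exact (f_hasDerivAt Q1 Q2 K1 K2 hx).deriv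

/-- The constant `E` of the explicit shock formula. -/
noncomputable def shE (Q1 Q2 K1 K2 : ℝ) : ℝ :=
  Q2 * K2 * (K1 - K2) + (Q2 * K2 - Q1 * K1) * (1 + K2)

/-- The numerator in the explicit shock formula. -/
noncomputable def shN (Q1 Q2 K1 K2 a b x : ℝ) : ℝ :=
  langD K1 K2 a * langD K1 K2 b + Q1 * K1 * (1 + K2) + shE Q1 Q2 K1 K2 * x

lemma S_eq (Q1 Q2 K1 K2 : ℝ) {a b : ℝ} (hab : a ≠ b) (ha : langD K1 K2 a ≠ 0)
    (hb : langD K1 K2 b ≠ 0) :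
    SFun (langQ1 Q1 K1 K2) (langQ2 Q2 K1 K2) a b
      = Real.log (shN Q1 Q2 K1 K2 a b b / shN Q1 Q2 K1 K2 a b a) := by
  have hab' : a - b ≠ 0 := sub_ne_zero.2 hab
  have e1 : alphaFun (langQ1 Q1 K1 K2) (langQ2 Q2 K1 K2) a b
      = 1 - (Q2 * K2 - Q1 * K1) * ((1 + K2) * (1 - a - b) - (K1 - K2) * a * b)
        / (langD K1 K2 a * langD K1 K2 b) := by
    simp only [alphaFun, fFun, hFun, langQ1, langQ2]
    field_simp
    simp only [langD]
    ring
  have e2 : alphaFun (langQ1 Q1 K1 K2) (langQ2 Q2 K1 K2) a b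
      + hFun (langQ1 Q1 K1 K2) (langQ2 Q2 K1 K2) a
      = shN Q1 Q2 K1 K2 a b b / (langD K1 K2 a * langD K1 K2 b) := by
    rw [e1]
    simp only [hFun, langQ1, langQ2, shN, shE]
    field_simp
    simp only [langD]
    ring
  have e3 : alphaFun (langQ1 Q1 K1 K2) (langQ2 Q2 K1 K2) a b
      + hFun (langQ1 Q1 K1 K2) (langQ2 Q2 K1 K2) b
      = shN Q1 Q2 K1 K2 a b a / (langD K1 K2 a * langD K1 K2 b) := by
    rw [e1]
    simp only [hFun, langQ1, langQ2, shN, shE]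
    field_simp
    simp only [langD]
    ring
  rw [SFun, e2, e3, div_div_div_cancel_right₀ (mul_ne_zero ha hb)]

/-- Binary Langmuir isotherms with `K1 ≥ K2` and `Q1·K1 < Q2·K2`:
`f'' = 2(Q2·K2 - Q1·K1)(1+K1)(1+K2)/D³ > 0`, `h' ≤ 0`, `q1'' ≤ 0 ≤ q2''`, the
shock curves are monotonous, and for arbitrary positive constants `f''` never
vanishes on `[0,1]` iff `Q1·K1 ≠ Q2·K2`. -/
theorem binary_langmuir_assumptions
    (Q1 Q2 K1 K2 : ℝ) (hQ1 : 0 < Q1) (hQ2 : 0 < Q2) (hK1 : 0 < K1) (hK2 : 0 < K2)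
    (hK : K2 ≤ K1) (hQK : Q1 * K1 < Q2 * K2) :
    (∀ c ∈ Icc (0:ℝ) 1,
        deriv (deriv (fFun (langQ1 Q1 K1 K2) (langQ2 Q2 K1 K2))) c
          = 2 * (Q2 * K2 - Q1 * K1) * (1 + K1) * (1 + K2) / (langD K1 K2 c) ^ 3 ∧
        0 < deriv (deriv (fFun (langQ1 Q1 K1 K2) (langQ2 Q2 K1 K2))) c ∧
        deriv (hFun (langQ1 Q1 K1 K2) (langQ2 Q2 K1 K2)) c ≤ 0 ∧
        deriv (deriv (langQ1 Q1 K1 K2)) c ≤ 0 ∧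
        0 ≤ deriv (deriv (langQ2 Q2 K1 K2)) c) ∧
    (∀ cp cm : ℝ, 0 ≤ cp → cp < cm → cm ≤ 1 →
        0 ≤ deriv (fun b => SFun (langQ1 Q1 K1 K2) (langQ2 Q2 K1 K2) cp b) cm ∧
        deriv (fun a => SFun (langQ1 Q1 K1 K2) (langQ2 Q2 K1 K2) a cm) cp ≤ 0) ∧
    (∀ Q1' Q2' K1' K2' : ℝ, 0 < Q1' → 0 < Q2' → 0 < K1' → 0 < K2' →
        ((∀ c ∈ Icc (0:ℝ) 1,
            deriv (deriv (fFun (langQ1 Q1' K1' K2') (langQ2 Q2' K1' K2'))) c ≠ 0)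
          ↔ Q1' * K1' ≠ Q2' * K2')) := by
  have hM : 0 < Q2 * K2 - Q1 * K1 := sub_pos.2 hQK
  have hk : 0 ≤ K1 - K2 := sub_nonneg.2 hK
  have hP : 0 < Q1 * K1 := mul_pos hQ1 hK1
  have hR : 0 < Q2 * K2 := mul_pos hQ2 hK2
  refine ⟨?_, ?_, ?_⟩
  · intro c hc
    have hD := langD_pos hK1 hK2 hc
    rw [f_deriv2 Q1 Q2 K1 K2 hD.ne', langQ1_deriv2 Q1 K1 K2 hD.ne', langQ2_deriv2 Q2 K1 K2 hD.ne']
    refine ⟨rfl, by positivity, ?_, ?_, ?_⟩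
    · have h' := (langQ1_hasDerivAt Q1 K1 K2 hD.ne').add (langQ2_hasDerivAt Q2 K1 K2 hD.ne')
      have e : deriv (hFun (langQ1 Q1 K1 K2) (langQ2 Q2 K1 K2)) c = _ := h'.deriv
      rw [e, ← add_div]
      apply div_nonpos_of_nonpos_of_nonneg _ (by positivity)
      nlinarith [mul_nonneg hR.le hk]
    · apply div_nonpos_of_nonpos_of_nonneg _ (by positivity)
      have : 0 ≤ 2 * (Q1 * K1 * (1 + K2)) * (K1 - K2) := by positivity
      linarith
    · apply div_nonneg _ (by positivity)
      have : 0 ≤ 2 * (Q2 * K2 * (1 + K1)) * (K1 - K2) := by positivity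
      linarith
  · intro a b ha hab hb
    have hb0 : 0 ≤ b := ha.trans hab.le
    have hDa : 0 < langD K1 K2 a := langD_pos hK1 hK2 ⟨ha, by linarith⟩
    have hDb : 0 < langD K1 K2 b := langD_pos hK1 hK2 ⟨hb0, hb⟩
    have hE : 0 < shE Q1 Q2 K1 K2 := by unfold shE; positivity
    have hNb : 0 < shN Q1 Q2 K1 K2 a b b := by unfold shN; positivity
    have hNa : 0 < shN Q1 Q2 K1 K2 a b a := by unfold shN; positivity
    have hq : 0 < shN Q1 Q2 K1 K2 a b b / shN Q1 Q2 K1 K2 a b a := div_pos hNb hNa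
    have dD : langD K1 K2 b - langD K1 K2 a = (K1 - K2) * (b - a) := by
      simp only [langD]; ring
    constructor
    · have hev : (fun y => SFun (langQ1 Q1 K1 K2) (langQ2 Q2 K1 K2) a y) =ᶠ[nhds b]
          fun y => Real.log (shN Q1 Q2 K1 K2 a y y / shN Q1 Q2 K1 K2 a y a) := by
        filter_upwards [langD_ev hDb.ne', eventually_ne_nhds hab.ne'] with y h1 h2
        exact S_eq Q1 Q2 K1 K2 h2.symm hDa.ne' h1
      have d1 : HasDerivAt (fun y => shN Q1 Q2 K1 K2 a y y)
          (langD K1 K2 a * (K1 - K2) + shE Q1 Q2 K1 K2 * 1) b :=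
        (((langD_hasDerivAt K1 K2 b).const_mul (langD K1 K2 a)).add_const _).add
          ((hasDerivAt_id b).const_mul _)
      have d2 : HasDerivAt (fun y => shN Q1 Q2 K1 K2 a y a)
          (langD K1 K2 a * (K1 - K2)) b :=
        (((langD_hasDerivAt K1 K2 b).const_mul (langD K1 K2 a)).add_const _).add_const _
      have d3 := (d1.div d2 hNa.ne').log hq.ne'
      rw [hev.deriv_eq]
      erw [d3.deriv]
      refine div_nonneg (div_nonneg ?_ (by positivity)) hq.le
      have : (langD K1 K2 a * (K1 - K2) + shE Q1 Q2 K1 K2 * 1) * shN Q1 Q2 K1 K2 a b a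
          - shN Q1 Q2 K1 K2 a b b * (langD K1 K2 a * (K1 - K2))
          = shE Q1 Q2 K1 K2 * (langD K1 K2 a ^ 2 + Q1 * K1 * (1 + K2) + shE Q1 Q2 K1 K2 * a) := by
        simp only [shN]
        linear_combination (shE Q1 Q2 K1 K2 * langD K1 K2 a) * dD
      rw [this]
      positivity
    · have hev : (fun y => SFun (langQ1 Q1 K1 K2) (langQ2 Q2 K1 K2) y b) =ᶠ[nhds a]
          fun y => Real.log (shN Q1 Q2 K1 K2 y b b / shN Q1 Q2 K1 K2 y b y) := by
        filter_upwards [langD_ev hDa.ne', eventually_ne_nhds hab.ne] with y h1 h2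
        exact S_eq Q1 Q2 K1 K2 h2 h1 hDb.ne'
      have d1 : HasDerivAt (fun y => shN Q1 Q2 K1 K2 y b y)
          ((K1 - K2) * langD K1 K2 b + shE Q1 Q2 K1 K2 * 1) a :=
        (((langD_hasDerivAt K1 K2 a).mul_const (langD K1 K2 b)).add_const _).add
          ((hasDerivAt_id a).const_mul _)
      have d2 : HasDerivAt (fun y => shN Q1 Q2 K1 K2 y b b)
          ((K1 - K2) * langD K1 K2 b) a :=
        (((langD_hasDerivAt K1 K2 a).mul_const (langD K1 K2 b)).add_const _).add_const _
      have d3 := (d2.div d1 hNa.ne').log hq.ne'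
      rw [hev.deriv_eq]
      erw [d3.deriv]
      refine div_nonpos_of_nonpos_of_nonneg
        (div_nonpos_of_nonpos_of_nonneg ?_ (by positivity)) hq.le
      have : ((K1 - K2) * langD K1 K2 b) * shN Q1 Q2 K1 K2 a b a
          - shN Q1 Q2 K1 K2 a b b * ((K1 - K2) * langD K1 K2 b + shE Q1 Q2 K1 K2 * 1)
          = -(shE Q1 Q2 K1 K2 *
            (langD K1 K2 b ^ 2 + Q1 * K1 * (1 + K2) + shE Q1 Q2 K1 K2 * b)) := by
        simp only [shN]
        linear_combination (shE Q1 Q2 K1 K2 * langD K1 K2 b) * dD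
      rw [this]
      apply neg_nonpos_of_nonneg
      positivity
  · intro P1 P2 L1 L2 hP1 hP2 hL1 hL2
    constructor
    · intro h e
      have h0 : (0:ℝ) ∈ Icc (0:ℝ) 1 := ⟨le_refl _, zero_le_one⟩
      apply h 0 h0
      rw [f_deriv2 P1 P2 L1 L2 (langD_pos hL1 hL2 h0).ne', e]
      simp
    · intro h c hc
      have hD := langD_pos hL1 hL2 hc
      rw [f_deriv2 P1 P2 L1 L2 hD.ne']
      have : P2 * L2 - P1 * L1 ≠ 0 := sub_ne_zero.2 h.symm
      have h1 : 1 + L1 ≠ 0 := by positivity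
      have h2 : 1 + L2 ≠ 0 := by positivity
      exact div_ne_zero (mul_ne_zero (mul_ne_zero (mul_ne_zero two_ne_zero this) h1) h2)
        (pow_ne_zero 3 hD.ne')
end

section
/- Let T : [0,1]² → ℝ be of class C³ with T(b,b) = 0 for every b ∈ [0,1]. Then there exists a constant Γ > 0 such that for all c_0, c_1, c_2 ∈ [0,1] and all L_0, L_1, L_2, L_1* ∈ ℝ satisfying L_1 − L_0 = T(c_1,c_0), L_2 − L_1 = T(c_2,c_1) and L_2 − L_1* = T(c_2,c_0) (interaction of two λ-waves), one has |L_1* − L_0| + |L_2 − L_1*| ≤ |L_1 − L_0| + |L_2 − L_1| + Γ·|c_2 − c_1|·|c_1 − c_0|. -/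
open Set

/-- Interaction of two λ-waves: the total variation of `L = log u` increases at
most quadratically with respect to the strengths of the incoming waves. -/
theorem two_wave_interaction_estimate
    (T : ℝ × ℝ → ℝ)
    (hT : ContDiffOn ℝ 3 T (Icc (0:ℝ) 1 ×ˢ Icc (0:ℝ) 1))
    (hT0 : ∀ b ∈ Icc (0:ℝ) 1, T (b, b) = 0) :
    ∃ Γ > 0, ∀ c0 ∈ Icc (0:ℝ) 1, ∀ c1 ∈ Icc (0:ℝ) 1, ∀ c2 ∈ Icc (0:ℝ) 1,
      ∀ L0 L1 L2 L1s : ℝ,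
      L1 - L0 = T (c1, c0) → L2 - L1 = T (c2, c1) → L2 - L1s = T (c2, c0) →
      |L1s - L0| + |L2 - L1s| ≤ |L1 - L0| + |L2 - L1| + Γ * |c2 - c1| * |c1 - c0| := by
  set S : Set (ℝ × ℝ) := Icc (0:ℝ) 1 ×ˢ Icc (0:ℝ) 1 with hS
  have hu : UniqueDiffOn ℝ S :=
    (uniqueDiffOn_Icc zero_lt_one).prod (uniqueDiffOn_Icc zero_lt_one)
  have hconv : Convex ℝ S := (convex_Icc _ _).prod (convex_Icc _ _)
  have hcpt : IsCompact S := isCompact_Icc.prod isCompact_Icc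
  have hD : ContDiffOn ℝ 1 (fderivWithin ℝ T S) S :=
    hT.fderivWithin hu (by norm_num)
  obtain ⟨K, hK⟩ := hD.exists_lipschitzOnWith one_ne_zero hconv hcpt
  have key : ∀ a ∈ Icc (0:ℝ) 1, ∀ b ∈ Icc (0:ℝ) 1, ∀ c ∈ Icc (0:ℝ) 1,
      |(T (c, b) - T (c, a)) - (T (b, b) - T (b, a))| ≤ K * |b - a| * |c - b| := by
    intro a ha b hb c hc
    have hder : ∀ y ∈ Icc (0:ℝ) 1, ∀ x ∈ Icc (0:ℝ) 1,
        HasDerivWithinAt (fun x => T (x, y)) (fderivWithin ℝ T S (x, y) (1, 0))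
          (Icc (0:ℝ) 1) x := by
      intro y hy x hx
      have h1 : HasFDerivWithinAt T (fderivWithin ℝ T S (x, y)) S (x, y) :=
        ((hT.differentiableOn (by norm_num)) (x, y) ⟨hx, hy⟩).hasFDerivWithinAt
      have h2 : HasDerivWithinAt (fun x : ℝ => (x, y)) ((1:ℝ), (0:ℝ)) (Icc (0:ℝ) 1) x :=
        (hasDerivWithinAt_id x _).prodMk (hasDerivWithinAt_const x _ y)
      have h3 : MapsTo (fun x : ℝ => (x, y)) (Icc (0:ℝ) 1) S := fun z hz => ⟨hz, hy⟩
      exact HasFDerivWithinAt.comp_hasDerivWithinAt (f := fun x : ℝ => (x, y)) x h1 h2 h3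
    have := Convex.norm_image_sub_le_of_norm_hasDerivWithin_le (𝕜 := ℝ)
      (f := fun x => T (x, b) - T (x, a))
      (C := K * |b - a|) (fun x hx => (hder b hb x hx).sub (hder a ha x hx))
      (fun x hx => ?_) (convex_Icc _ _) hb hc
    · simpa [Real.norm_eq_abs] using this
    · have hl := hK.norm_sub_le (x := (x, b)) ⟨hx, hb⟩ (y := (x, a)) ⟨hx, ha⟩
      have h3 := (fderivWithin ℝ T S (x, b) - fderivWithin ℝ T S (x, a)).le_opNorm (1, 0)
      have h4 : ‖((1:ℝ), (0:ℝ))‖ = 1 := by simp [Prod.norm_def]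
      have h5 : ‖((x, b) : ℝ × ℝ) - (x, a)‖ = |b - a| := by simp [Prod.norm_def]
      rw [h4, mul_one] at h3
      rw [h5] at hl
      exact h3.trans hl
  refine ⟨2 * K + 1, by positivity, ?_⟩
  intro a ha b hb c hc L0 L1 L2 L1s h1 h2 h3
  have hk := key a ha b hb c hc
  rw [hT0 b hb] at hk
  have e : (T (c, b) - T (c, a)) - (0 - T (b, a)) = L1s - L0 := by linarith
  rw [e] at hk
  have h6 : |L2 - L1s| ≤ |L1 - L0| + |L2 - L1| + |L1s - L0| := by
    have : L2 - L1s = (L1 - L0) + (L2 - L1) - (L1s - L0) := by ring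
    rw [this]
    exact (abs_sub _ _).trans (by gcongr; exact abs_add_le _ _)
  have h7 : 0 ≤ |c - b| * |b - a| := by positivity
  nlinarith
end

section
/- Assume q1, q2 are C⁴ on a neighborhood of [0,1] with q1' ≥ 0, q2' ≤ 0, h' ≤ 0 and f'' > 0 on [0,1]. Then there exists a constant Γ > 0 such that for all c_0, c_1, c_2 ∈ [0,1] and all L_0, L_1, L_2, L_1* ∈ ℝ satisfying: (i) for i = 0 and i = 1, either c_{i+1} = c_i (a contact discontinuity) or L_{i+1} − L_i = T(c_{i+1},c_i) (a λ-wave); and (ii) L_2 − L_1* = T(c_2,c_0); one has, with c_1* = c_0: |c_1* − c_0| + |c_2 − c_1*| ≤ |c_1 − c_0| + |c_2 − c_1| (the total variation of the concentration does not increase) and |L_1* − L_0| + |L_2 − L_1*| ≤ |L_1 − L_0| + |L_2 − L_1| + Γ·|c_0 − c_1|·|c_1 − c_2|. -/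
open Set

/-- The λ-wave curve: `T(a,b) = g(b) - g(a)` for a rarefaction (`b ≤ a`) and
`T(a,b) = S(a,b)` for a shock (`a < b`); `L₊ - L₋ = T(c₊,c₋)`. -/
noncomputable def TFun (q1 q2 g : ℝ → ℝ) (a b : ℝ) : ℝ :=
  if b ≤ a then g b - g a else SFun q1 q2 a b

/-- Bounded, Lipschitz in each variable, and with mixed differences controlled, on the unit square. -/
def Good (u : ℝ → ℝ → ℝ) : Prop :=
  ∃ C : ℝ, 0 ≤ C ∧ ∀ x ∈ Icc (0:ℝ) 1, ∀ y ∈ Icc (0:ℝ) 1, ∀ z ∈ Icc (0:ℝ) 1, ∀ w ∈ Icc (0:ℝ) 1,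
    |u x z| ≤ C ∧ |u x z - u y z| ≤ C * |x - y| ∧ |u x z - u x w| ≤ C * |z - w| ∧
    |u x z - u y z - u x w + u y w| ≤ C * (|x - y| * |z - w|)

lemma Good.const (k : ℝ) : Good (fun _ _ => k) := by
  refine ⟨|k|, abs_nonneg _, fun x _ y _ z _ w _ => ?_⟩
  simp only [sub_self, abs_zero, zero_sub, neg_add_cancel]
  refine ⟨le_rfl, ?_, ?_, ?_⟩ <;> positivity

lemma Good.fst : Good (fun a _ => a) := by
  refine ⟨1, zero_le_one, fun x hx y _ z _ w _ => ⟨?_, by simp, ?_, ?_⟩⟩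
  · rw [abs_of_nonneg hx.1]; exact hx.2
  · simp
  · have : x - y - x + y = 0 := by ring
    rw [this, abs_zero]; positivity

lemma Good.snd : Good (fun _ b => b) := by
  refine ⟨1, zero_le_one, fun x _ y _ z hz w _ => ⟨?_, by simp, by simp, ?_⟩⟩
  · rw [abs_of_nonneg hz.1]; exact hz.2
  · have : z - z - w + w = 0 := by ring
    rw [this, abs_zero]; positivity

lemma Good.add {u v : ℝ → ℝ → ℝ} (hu : Good u) (hv : Good v) :
    Good (fun a b => u a b + v a b) := by
  obtain ⟨C, hC, hu⟩ := hu
  obtain ⟨D, hD, hv⟩ := hv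
  refine ⟨C + D, by positivity, fun x hx y hy z hz w hw => ?_⟩
  obtain ⟨a1, a2, a3, a4⟩ := hu x hx y hy z hz w hw
  obtain ⟨b1, b2, b3, b4⟩ := hv x hx y hy z hz w hw
  refine ⟨(abs_add_le _ _).trans (add_le_add a1 b1), ?_, ?_, ?_⟩
  · calc _ = |(u x z - u y z) + (v x z - v y z)| := by congr 1; ring
      _ ≤ _ := (abs_add_le _ _).trans (by linarith)
  · calc _ = |(u x z - u x w) + (v x z - v x w)| := by congr 1; ring
      _ ≤ _ := (abs_add_le _ _).trans (by linarith)
  · calc _ = |(u x z - u y z - u x w + u y w) + (v x z - v y z - v x w + v y w)| := by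
          congr 1; ring
      _ ≤ _ := (abs_add_le _ _).trans (by linarith)

lemma Good.mul {u v : ℝ → ℝ → ℝ} (hu : Good u) (hv : Good v) :
    Good (fun a b => u a b * v a b) := by
  obtain ⟨C, hC, hu⟩ := hu
  obtain ⟨D, hD, hv⟩ := hv
  refine ⟨4 * (C * D), by positivity, fun x hx y hy z hz w hw => ?_⟩
  have hCD : 0 ≤ C * D := by positivity
  have key : ∀ {s t S T : ℝ}, |s| ≤ S → |t| ≤ T → |s * t| ≤ S * T := by
    intro s t S T h1 h2
    rw [abs_mul]
    exact mul_le_mul h1 h2 (abs_nonneg _) ((abs_nonneg _).trans h1)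
  obtain ⟨a1, a2, a3, a4⟩ := hu x hx y hy z hz w hw
  obtain ⟨b1, b2, b3, b4⟩ := hv x hx y hy z hz w hw
  obtain ⟨c1, -, c3, -⟩ := hu y hy x hx z hz w hw
  obtain ⟨d1, -, -, -⟩ := hu x hx y hy w hw z hz
  obtain ⟨e1, e2, -, -⟩ := hu x hx y hy w hw z hz
  obtain ⟨f1, -, -, -⟩ := hu y hy x hx w hw z hz
  have n1 := mul_nonneg hCD (abs_nonneg (x - y))
  have n2 := mul_nonneg hCD (abs_nonneg (z - w))
  refine ⟨(key a1 b1).trans (by linarith), ?_, ?_, ?_⟩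
  · calc _ = |(u x z - u y z) * v x z + u y z * (v x z - v y z)| := by congr 1; ring
      _ ≤ _ := (abs_add_le _ _).trans (by have := key a2 b1; have := key c1 b2; nlinarith)
  · calc _ = |(u x z - u x w) * v x z + u x w * (v x z - v x w)| := by congr 1; ring
      _ ≤ _ := (abs_add_le _ _).trans (by have := key a3 b1; have := key d1 b3; nlinarith)
  · have k1 := key a4 b1
    have k2 := key c3 b2
    have k3 := key e2 b3
    have k4 := key f1 b4
    calc _ = |((u x z - u y z - u x w + u y w) * v x z + (u y z - u y w) * (v x z - v y z))
          + ((u x w - u y w) * (v x z - v x w) + u y w * (v x z - v y z - v x w + v y w))| := by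
          congr 1; ring
      _ ≤ _ := (abs_add_le _ _).trans (add_le_add (abs_add_le _ _) (abs_add_le _ _))
      _ ≤ _ := add_le_add (add_le_add k1 k2) (add_le_add k3 k4)
      _ = _ := by ring

lemma abs_log_sub_le {p q : ℝ} (hp : 1 ≤ p) (hq : 1 ≤ q) : |Real.log p - Real.log q| ≤ |p - q| := by
  have aux : ∀ {p q : ℝ}, 1 ≤ p → 1 ≤ q → Real.log p - Real.log q ≤ |p - q| := by
    intro p q hp hq
    rw [← Real.log_div (by positivity) (by positivity)]
    have h1 := Real.log_le_sub_one_of_pos (show 0 < p / q by positivity)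
    have h2 : p / q - 1 = (p - q) / q := by field_simp
    have h3 : (p - q) / q ≤ |p - q| / q := by gcongr; exact le_abs_self _
    have h4 : |p - q| / q ≤ |p - q| := div_le_self (abs_nonneg _) hq
    linarith
  rw [abs_le]
  have h1 := aux hp hq
  have h2 := aux hq hp
  rw [abs_sub_comm] at h2
  constructor <;> linarith

lemma Good.log_mixed {u : ℝ → ℝ → ℝ} (hu : Good u)
    (h1 : ∀ a ∈ Icc (0:ℝ) 1, ∀ b ∈ Icc (0:ℝ) 1, 1 ≤ u a b) :
    ∃ C : ℝ, 0 ≤ C ∧ ∀ x ∈ Icc (0:ℝ) 1, ∀ y ∈ Icc (0:ℝ) 1, ∀ z ∈ Icc (0:ℝ) 1,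
      ∀ w ∈ Icc (0:ℝ) 1,
      |Real.log (u x z) - Real.log (u y z) - Real.log (u x w) + Real.log (u y w)|
        ≤ C * (|x - y| * |z - w|) := by
  obtain ⟨C, hC, hu⟩ := hu
  refine ⟨2 * (C * C), by positivity, fun x hx y hy z hz w hw => ?_⟩
  obtain ⟨-, -, -, a4⟩ := hu x hx y hy z hz w hw
  obtain ⟨-, -, c3, -⟩ := hu y hy x hx z hz w hw
  obtain ⟨-, e2, -, -⟩ := hu x hx y hy w hw z hz
  obtain ⟨f1, -, -, -⟩ := hu y hy x hx w hw z hz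
  have g1 := h1 x hx z hz
  have g2 := h1 y hy z hz
  have g3 := h1 x hx w hw
  have g4 := h1 y hy w hw
  have key : ∀ {s t S T : ℝ}, |s| ≤ S → |t| ≤ T → |s * t| ≤ S * T := by
    intro s t S T h1 h2
    rw [abs_mul]
    exact mul_le_mul h1 h2 (abs_nonneg _) ((abs_nonneg _).trans h1)
  have k1 := key f1 a4
  have k2 := key c3 e2
  calc _ = |Real.log (u x z * u y w) - Real.log (u y z * u x w)| := by
        rw [Real.log_mul (by positivity) (by positivity), Real.log_mul (by positivity) (by positivity)]
        congr 1; ring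
    _ ≤ |u x z * u y w - u y z * u x w| := abs_log_sub_le (by nlinarith) (by nlinarith)
    _ = |u y w * (u x z - u y z - u x w + u y w) - (u y z - u y w) * (u x w - u y w)| := by
        congr 1; ring
    _ ≤ _ := (abs_sub _ _).trans (add_le_add k1 k2)
    _ = _ := by ring

/-- Regularity package on the unit interval. -/
structure Reg (q : ℝ → ℝ) (M : ℝ) : Prop where
  d0 : ∀ x ∈ Icc (0:ℝ) 1, HasDerivAt q (deriv q x) x
  d1 : ∀ x ∈ Icc (0:ℝ) 1, HasDerivAt (deriv q) (deriv (deriv q) x) x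
  d2 : ∀ x ∈ Icc (0:ℝ) 1, HasDerivAt (deriv (deriv q)) (deriv (deriv (deriv q)) x) x
  nn : 0 ≤ M
  b1 : ∀ x ∈ Icc (0:ℝ) 1, |deriv q x| ≤ M
  b2 : ∀ x ∈ Icc (0:ℝ) 1, |deriv (deriv q) x| ≤ M
  b3 : ∀ x ∈ Icc (0:ℝ) 1, |deriv (deriv (deriv q)) x| ≤ M

lemma exists_reg {q : ℝ → ℝ} {U : Set ℝ} (hU : IsOpen U) (hs : Icc (0:ℝ) 1 ⊆ U)
    (hq : ContDiffOn ℝ 4 q U) : ∃ M, Reg q M := by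
  have c1 : ContDiffOn ℝ 3 (deriv q) U := hq.deriv_of_isOpen hU (by norm_num)
  have c2 : ContDiffOn ℝ 2 (deriv (deriv q)) U := c1.deriv_of_isOpen hU (by norm_num)
  have c3 : ContDiffOn ℝ 1 (deriv (deriv (deriv q))) U := c2.deriv_of_isOpen hU (by norm_num)
  have bd : ∀ {φ : ℝ → ℝ}, ContinuousOn φ U → ∃ M, ∀ x ∈ Icc (0:ℝ) 1, |φ x| ≤ M := by
    intro φ hφ
    exact isCompact_Icc.exists_bound_of_continuousOn (hφ.mono hs)
  have dd : ∀ {φ : ℝ → ℝ}, DifferentiableOn ℝ φ U → ∀ x ∈ Icc (0:ℝ) 1,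
      HasDerivAt φ (deriv φ x) x := by
    intro φ hφ x hx
    exact (hφ.differentiableAt (hU.mem_nhds (hs hx))).hasDerivAt
  obtain ⟨M1, h1⟩ := bd c1.continuousOn
  obtain ⟨M2, h2⟩ := bd c2.continuousOn
  obtain ⟨M3, h3⟩ := bd c3.continuousOn
  have z : (0:ℝ) ∈ Icc (0:ℝ) 1 := by simp
  have p1 := (abs_nonneg _).trans (h1 0 z)
  have p2 := (abs_nonneg _).trans (h2 0 z)
  have p3 := (abs_nonneg _).trans (h3 0 z)
  refine ⟨M1 + M2 + M3, dd (hq.differentiableOn (by norm_num)), dd (c1.differentiableOn (by norm_num)),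
    dd (c2.differentiableOn (by norm_num)), by positivity, fun x hx => ?_, fun x hx => ?_, fun x hx => ?_⟩
  · linarith [h1 x hx]
  · linarith [h2 x hx]
  · linarith [h3 x hx]

/-- Divided difference in integral form. -/
noncomputable def DD (q : ℝ → ℝ) (a b : ℝ) : ℝ := ∫ t in (0:ℝ)..1, deriv q (t * a + (1 - t) * b)

lemma mem_seg {a b t : ℝ} (ha : a ∈ Icc (0:ℝ) 1) (hb : b ∈ Icc (0:ℝ) 1) (ht : t ∈ Icc (0:ℝ) 1) :
    t * a + (1 - t) * b ∈ Icc (0:ℝ) 1 := by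
  obtain ⟨h1, h2⟩ := ha
  obtain ⟨h3, h4⟩ := hb
  obtain ⟨h5, h6⟩ := ht
  have h7 : 0 ≤ 1 - t := by linarith
  constructor
  · positivity
  · nlinarith

lemma Reg.cont {q : ℝ → ℝ} {M : ℝ} (h : Reg q M) {a b : ℝ}
    (ha : a ∈ Icc (0:ℝ) 1) (hb : b ∈ Icc (0:ℝ) 1) :
    IntervalIntegrable (fun t => deriv q (t * a + (1 - t) * b)) MeasureTheory.volume 0 1 := by
  apply ContinuousOn.intervalIntegrable
  rw [uIcc_of_le zero_le_one]
  have h1 : ContinuousOn (deriv q) (Icc 0 1) := fun x hx =>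
    (h.d1 x hx).continuousAt.continuousWithinAt
  exact h1.comp (by fun_prop) (fun t ht => mem_seg ha hb ht)

lemma Reg.lip {q : ℝ → ℝ} {M : ℝ} (h : Reg q M) {x y : ℝ}
    (hx : x ∈ Icc (0:ℝ) 1) (hy : y ∈ Icc (0:ℝ) 1) : |deriv q x - deriv q y| ≤ M * |x - y| :=
  (convex_Icc (0:ℝ) 1).norm_image_sub_le_of_norm_hasDerivWithin_le
    (fun s hs => (h.d1 s hs).hasDerivWithinAt) (fun s hs => h.b2 s hs) hy hx

lemma Reg.lip2 {q : ℝ → ℝ} {M : ℝ} (h : Reg q M) {x y : ℝ}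
    (hx : x ∈ Icc (0:ℝ) 1) (hy : y ∈ Icc (0:ℝ) 1) :
    |deriv (deriv q) x - deriv (deriv q) y| ≤ M * |x - y| :=
  (convex_Icc (0:ℝ) 1).norm_image_sub_le_of_norm_hasDerivWithin_le
    (fun s hs => (h.d2 s hs).hasDerivWithinAt) (fun s hs => h.b3 s hs) hy hx

lemma integral_bd {F : ℝ → ℝ} {C : ℝ} (h : ∀ t ∈ Icc (0:ℝ) 1, |F t| ≤ C) :
    |∫ t in (0:ℝ)..1, F t| ≤ C := by
  have := intervalIntegral.norm_integral_le_of_norm_le_const (a := (0:ℝ)) (b := 1) (f := F) (C := C)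
    (fun t ht => by
      rw [uIoc_of_le zero_le_one] at ht
      exact h t ⟨ht.1.le, ht.2⟩)
  simpa using this

lemma Reg.mixed {q : ℝ → ℝ} {M : ℝ} (h : Reg q M) {x y z w t : ℝ}
    (hx : x ∈ Icc (0:ℝ) 1) (hy : y ∈ Icc (0:ℝ) 1) (hz : z ∈ Icc (0:ℝ) 1) (hw : w ∈ Icc (0:ℝ) 1)
    (ht : t ∈ Icc (0:ℝ) 1) :
    |deriv q (t * x + (1 - t) * z) - deriv q (t * y + (1 - t) * z)
      - deriv q (t * x + (1 - t) * w) + deriv q (t * y + (1 - t) * w)|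
      ≤ M * (|x - y| * |z - w|) := by
  have hM := h.nn
  have dp : ∀ x ∈ Icc (0:ℝ) 1, ∀ s ∈ Icc (0:ℝ) 1,
      HasDerivAt (fun s => deriv q (t * x + (1 - t) * s))
        (deriv (deriv q) (t * x + (1 - t) * s) * (1 - t)) s := by
    intro x hx s hs
    have h1 : HasDerivAt (fun s => t * x + (1 - t) * s) (1 - t) s := by
      simpa using ((hasDerivAt_id s).const_mul (1 - t)).const_add (t * x)
    exact (h.d1 _ (mem_seg hx hs ht)).comp s h1
  have := (convex_Icc (0:ℝ) 1).norm_image_sub_le_of_norm_hasDerivWithin_le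
    (f := fun s => deriv q (t * x + (1 - t) * s) - deriv q (t * y + (1 - t) * s))
    (C := M * |x - y|)
    (fun s hs => ((dp x hx s hs).sub (dp y hy s hs)).hasDerivWithinAt) (fun s hs => by
      have h1 := h.lip2 (mem_seg hx hs ht) (mem_seg hy hs ht)
      have e : t * x + (1 - t) * s - (t * y + (1 - t) * s) = t * (x - y) := by ring
      rw [e, abs_mul, abs_of_nonneg ht.1] at h1
      rw [← sub_mul, Real.norm_eq_abs, abs_mul, abs_of_nonneg (by linarith [ht.2] : 0 ≤ 1 - t)]
      have n := mul_nonneg hM (abs_nonneg (x - y))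
      calc _ ≤ M * (t * |x - y|) * 1 := by
            apply mul_le_mul h1 (by linarith [ht.1]) (by linarith [ht.2])
            have := ht.1
            positivity
        _ ≤ _ := by nlinarith [ht.2]) hw hz
  rw [Real.norm_eq_abs, Real.norm_eq_abs] at this
  calc _ = _ := by congr 1; ring
    _ ≤ _ := this
    _ = _ := by ring

lemma Reg.good {q : ℝ → ℝ} {M : ℝ} (h : Reg q M) : Good (DD q) := by
  refine ⟨M, h.nn, fun x hx y hy z hz w hw => ⟨?_, ?_, ?_, ?_⟩⟩
  · exact integral_bd fun t ht => h.b1 _ (mem_seg hx hz ht)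
  · unfold DD
    rw [← intervalIntegral.integral_sub (h.cont hx hz) (h.cont hy hz)]
    refine integral_bd fun t ht => (h.lip (mem_seg hx hz ht) (mem_seg hy hz ht)).trans ?_
    have e : t * x + (1 - t) * z - (t * y + (1 - t) * z) = t * (x - y) := by ring
    rw [e, abs_mul, abs_of_nonneg ht.1]
    exact mul_le_mul_of_nonneg_left (mul_le_of_le_one_left (abs_nonneg _) ht.2) h.nn
  · unfold DD
    rw [← intervalIntegral.integral_sub (h.cont hx hz) (h.cont hx hw)]
    refine integral_bd fun t ht => (h.lip (mem_seg hx hz ht) (mem_seg hx hw ht)).trans ?_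
    have e : t * x + (1 - t) * z - (t * x + (1 - t) * w) = (1 - t) * (z - w) := by ring
    rw [e, abs_mul, abs_of_nonneg (by linarith [ht.2] : 0 ≤ 1 - t)]
    exact mul_le_mul_of_nonneg_left (mul_le_of_le_one_left (abs_nonneg _) (by linarith [ht.1])) h.nn
  · unfold DD
    rw [← intervalIntegral.integral_sub (h.cont hx hz) (h.cont hy hz),
      ← intervalIntegral.integral_sub ((h.cont hx hz).sub (h.cont hy hz)) (h.cont hx hw),
      ← intervalIntegral.integral_add (((h.cont hx hz).sub (h.cont hy hz)).sub (h.cont hx hw))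
        (h.cont hy hw)]
    exact integral_bd fun t ht => h.mixed hx hy hz hw ht

lemma Reg.dd_mul {q : ℝ → ℝ} {M : ℝ} (h : Reg q M) {a b : ℝ}
    (ha : a ∈ Icc (0:ℝ) 1) (hb : b ∈ Icc (0:ℝ) 1) : DD q a b * (a - b) = q a - q b := by
  have := intervalIntegral.integral_eq_sub_of_hasDerivAt (a := (0:ℝ)) (b := 1)
    (f := fun t => q (t * a + (1 - t) * b))
    (f' := fun t => deriv q (t * a + (1 - t) * b) * (a - b)) (fun t ht => by
      rw [uIcc_of_le zero_le_one] at ht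
      have h1 : HasDerivAt (fun t => t * a + (1 - t) * b) (a - b) t := by
        have e : (fun t : ℝ => t * a + (1 - t) * b) = fun t => b + t * (a - b) := by
          funext t; ring
        rw [e]
        simpa using ((hasDerivAt_id t).mul_const (a - b)).const_add b
      exact (h.d0 _ (mem_seg ha hb ht)).comp t h1) ((h.cont ha hb).mul_const _)
  rw [intervalIntegral.integral_mul_const] at this
  unfold DD
  rw [this]
  simp

lemma Reg.dd_near {q : ℝ → ℝ} {M : ℝ} (h : Reg q M) {a b ξ : ℝ}
    (ha : a ∈ Icc (0:ℝ) 1) (hb : b ∈ Icc (0:ℝ) 1) (h1 : a ≤ ξ) (h2 : ξ ≤ b) :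
    |DD q a b - deriv q ξ| ≤ M * (b - a) := by
  have hξ : ξ ∈ Icc (0:ℝ) 1 := ⟨ha.1.trans h1, h2.trans hb.2⟩
  have e : deriv q ξ = ∫ t in (0:ℝ)..1, deriv q ξ := by simp
  rw [e]
  unfold DD
  rw [← intervalIntegral.integral_sub (h.cont ha hb) (by simp)]
  refine integral_bd fun t ht => (h.lip (mem_seg ha hb ht) hξ).trans ?_
  refine mul_le_mul_of_nonneg_left ?_ h.nn
  rw [abs_le]
  have := ht.1
  have := ht.2
  constructor <;> nlinarith

lemma dd_nonneg {q : ℝ → ℝ} (h : ∀ x ∈ Icc (0:ℝ) 1, 0 ≤ deriv q x) {a b : ℝ}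
    (ha : a ∈ Icc (0:ℝ) 1) (hb : b ∈ Icc (0:ℝ) 1) : 0 ≤ DD q a b :=
  intervalIntegral.integral_nonneg zero_le_one fun _ ht => h _ (mem_seg ha hb ht)

lemma dd_nonpos {q : ℝ → ℝ} (h : ∀ x ∈ Icc (0:ℝ) 1, deriv q x ≤ 0) {a b : ℝ}
    (ha : a ∈ Icc (0:ℝ) 1) (hb : b ∈ Icc (0:ℝ) 1) : DD q a b ≤ 0 := by
  have : 0 ≤ ∫ t in (0:ℝ)..1, - deriv q (t * a + (1 - t) * b) :=
    intervalIntegral.integral_nonneg zero_le_one fun t ht => by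
      have := h _ (mem_seg ha hb ht)
      linarith
  rw [intervalIntegral.integral_neg] at this
  unfold DD
  linarith

lemma log_one_add_bd {x : ℝ} (hx : 0 ≤ x) : |Real.log (1 + x) - x| ≤ x ^ 2 := by
  have h1 := Real.log_le_sub_one_of_pos (show 0 < 1 + x by positivity)
  have h2 := Real.one_sub_inv_le_log_of_pos (show 0 < 1 + x by positivity)
  have h3 : 1 - (1 + x)⁻¹ = x - x ^ 2 / (1 + x) := by field_simp; ring
  have h4 : x ^ 2 / (1 + x) ≤ x ^ 2 := div_le_self (by positivity) (by linarith)
  rw [abs_le]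
  constructor <;> nlinarith

/-- Mixed and quadratic estimates imply the estimate for the defect of the wave function. -/
lemma defect {E R : ℝ → ℝ → ℝ} {A B : ℝ} (hA : 0 ≤ A) (hB : 0 ≤ B)
    (E0 : ∀ a, E a a = 0)
    (hmix : ∀ x ∈ Icc (0:ℝ) 1, ∀ y ∈ Icc (0:ℝ) 1, ∀ z ∈ Icc (0:ℝ) 1, ∀ w ∈ Icc (0:ℝ) 1,
      |E x z - E y z - E x w + E y w| ≤ A * (|x - y| * |z - w|))
    (hq : ∀ a ∈ Icc (0:ℝ) 1, ∀ b ∈ Icc (0:ℝ) 1, a < b → |E a b| ≤ B * (b - a) ^ 2)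
    (R1 : ∀ a b, b ≤ a → R a b = 0) (R2 : ∀ a b, a < b → R a b = E a b)
    {c0 c1 c2 : ℝ} (h0 : c0 ∈ Icc (0:ℝ) 1) (h1 : c1 ∈ Icc (0:ℝ) 1) (h2 : c2 ∈ Icc (0:ℝ) 1) :
    |R c2 c1 + R c1 c0 - R c2 c0| ≤ (A + B) * (|c0 - c1| * |c1 - c2|) := by
  have hq' : ∀ a ∈ Icc (0:ℝ) 1, ∀ b ∈ Icc (0:ℝ) 1, a ≤ b → |E a b| ≤ B * (b - a) ^ 2 := by
    intro a ha b hb hab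
    rcases hab.lt_or_eq with h | h
    · exact hq a ha b hb h
    · subst h; simp [E0]
  have R2' : ∀ a b, a ≤ b → R a b = E a b := by
    intro a b hab
    rcases hab.lt_or_eq with h | h
    · exact R2 a b h
    · subst h; rw [R1 a a le_rfl, E0]
  rcases le_total c1 c0 with p | p <;> rcases le_total c2 c1 with r | r
  · rw [R2' _ _ r, R2' _ _ p, R2' _ _ (r.trans p)]
    have := hmix c2 h2 c1 h1 c1 h1 c0 h0
    rw [E0, abs_sub_comm c2 c1, abs_sub_comm c1 c0] at this
    have n : 0 ≤ B * (|c0 - c1| * |c1 - c2|) := by positivity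
    calc _ = |E c2 c1 - 0 - E c2 c0 + E c1 c0| := by congr 1; ring
      _ ≤ _ := by nlinarith
  · rw [R1 _ _ r, R2' _ _ p, abs_of_nonneg (sub_nonneg.2 p), abs_of_nonpos (sub_nonpos.2 r)]
    have p' := sub_nonneg.2 p
    have r' := sub_nonneg.2 r
    rcases le_total c2 c0 with s | s
    · rw [R2' _ _ s]
      have s' := sub_nonneg.2 s
      have m := hmix c1 h1 c2 h2 c0 h0 c2 h2
      have k := hq' c1 h1 c2 h2 r
      rw [E0, abs_of_nonneg s', abs_of_nonpos (sub_nonpos.2 r)] at m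
      have m2 : A * (-(c1 - c2) * (c0 - c2)) ≤ A * ((c0 - c1) * -(c1 - c2)) :=
        mul_le_mul_of_nonneg_left (by nlinarith) hA
      have k2 : B * (c2 - c1) ^ 2 ≤ B * ((c0 - c1) * -(c1 - c2)) :=
        mul_le_mul_of_nonneg_left (by nlinarith) hB
      calc _ = |(E c1 c0 - E c2 c0 - E c1 c2 + 0) + E c1 c2| := by congr 1; ring
        _ ≤ _ := (abs_add_le _ _).trans (by linarith)
    · rw [R1 _ _ s]
      have k := hq' c1 h1 c0 h0 p
      have k2 : B * (c0 - c1) ^ 2 ≤ B * ((c0 - c1) * -(c1 - c2)) :=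
        mul_le_mul_of_nonneg_left (by nlinarith) hB
      have n : 0 ≤ A * ((c0 - c1) * -(c1 - c2)) :=
        mul_nonneg hA (mul_nonneg p' (by linarith))
      rw [zero_add, sub_zero]
      linarith
  · rw [R1 _ _ p, R2' _ _ r, abs_of_nonpos (sub_nonpos.2 p), abs_of_nonneg (sub_nonneg.2 r)]
    have p' := sub_nonneg.2 p
    have r' := sub_nonneg.2 r
    rcases le_total c2 c0 with s | s
    · rw [R2' _ _ s]
      have s' := sub_nonneg.2 s
      have m := hmix c2 h2 c0 h0 c1 h1 c0 h0
      have k := hq' c0 h0 c1 h1 p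
      rw [E0, abs_of_nonneg p', abs_of_nonpos (sub_nonpos.2 s)] at m
      have m2 : A * (-(c2 - c0) * (c1 - c0)) ≤ A * (-(c0 - c1) * (c1 - c2)) :=
        mul_le_mul_of_nonneg_left (by nlinarith) hA
      have k2 : B * (c1 - c0) ^ 2 ≤ B * (-(c0 - c1) * (c1 - c2)) :=
        mul_le_mul_of_nonneg_left (by nlinarith) hB
      calc _ = |(E c2 c1 - E c0 c1 - E c2 c0 + 0) + E c0 c1| := by congr 1; ring
        _ ≤ _ := (abs_add_le _ _).trans (by linarith)
    · rw [R1 _ _ s]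
      have k := hq' c2 h2 c1 h1 r
      have k2 : B * (c1 - c2) ^ 2 ≤ B * (-(c0 - c1) * (c1 - c2)) :=
        mul_le_mul_of_nonneg_left (by nlinarith) hB
      have n : 0 ≤ A * (-(c0 - c1) * (c1 - c2)) :=
        mul_nonneg hA (mul_nonneg (by linarith) r')
      rw [add_zero, sub_zero]
      linarith
  · rw [R1 _ _ r, R1 _ _ p, R1 _ _ (p.trans r)]
    simp only [add_zero, sub_zero, abs_zero]
    positivity

set_option maxHeartbeats 1000000 in
/-- Interaction estimate (Theorem 6.1, part 1): under genuine nonlinearity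
(`f'' > 0`), the total variation of the concentration does not increase and the
total variation of `L = log u` increases at most by `Γ·|c₀-c₁|·|c₁-c₂|`. -/
theorem interaction_estimate_genuinely_nonlinear
    (q1 q2 g : ℝ → ℝ)
    (hreg : ∃ U : Set ℝ, IsOpen U ∧ Icc (0:ℝ) 1 ⊆ U ∧
      ContDiffOn ℝ 4 q1 U ∧ ContDiffOn ℝ 4 q2 U)
    (hq1' : ∀ c ∈ Icc (0:ℝ) 1, 0 ≤ deriv q1 c)
    (hq2' : ∀ c ∈ Icc (0:ℝ) 1, deriv q2 c ≤ 0)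
    (hh' : ∀ c ∈ Icc (0:ℝ) 1, deriv (hFun q1 q2) c ≤ 0)
    (hf'' : ∀ c ∈ Icc (0:ℝ) 1, 0 < deriv (deriv (fFun q1 q2)) c)
    (hg : ∀ c ∈ Icc (0:ℝ) 1,
      HasDerivAt g (-(deriv (hFun q1 q2) c) / HFun q1 q2 c) c) :
    ∃ Γ > 0, ∀ c0 ∈ Icc (0:ℝ) 1, ∀ c1 ∈ Icc (0:ℝ) 1, ∀ c2 ∈ Icc (0:ℝ) 1,
      ∀ L0 L1 L2 L1s : ℝ,
      (c1 = c0 ∨ L1 - L0 = TFun q1 q2 g c1 c0) →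
      (c2 = c1 ∨ L2 - L1 = TFun q1 q2 g c2 c1) →
      L2 - L1s = TFun q1 q2 g c2 c0 →
      (|c0 - c0| + |c2 - c0| ≤ |c1 - c0| + |c2 - c1|) ∧
      (|L1s - L0| + |L2 - L1s| ≤ |L1 - L0| + |L2 - L1| + Γ * |c0 - c1| * |c1 - c2|) := by
  obtain ⟨U, hU, hs, r1, r2⟩ := hreg
  obtain ⟨M1, g1⟩ := exists_reg hU hs r1
  obtain ⟨M2, g2⟩ := exists_reg (q := hFun q1 q2) hU hs (r1.add r2)
  have hM1 := g1.nn
  have hM2 := g2.nn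
  set h := hFun q1 q2 with hh
  set Q := DD q1 with hQ
  set K := DD h with hK
  have Qn : ∀ a ∈ Icc (0:ℝ) 1, ∀ b ∈ Icc (0:ℝ) 1, 0 ≤ Q a b := fun a ha b hb => dd_nonneg hq1' ha hb
  have Kn : ∀ a ∈ Icc (0:ℝ) 1, ∀ b ∈ Icc (0:ℝ) 1, K a b ≤ 0 := fun a ha b hb => dd_nonpos hh' ha hb
  have G1 : Good (fun a b => (1 + Q a b) + b * ((-1) * K a b)) :=
    ((Good.const 1).add g1.good).add (Good.snd.mul ((Good.const (-1)).mul g2.good))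
  have G2 : Good (fun a b => (1 + Q a b) + a * ((-1) * K a b)) :=
    ((Good.const 1).add g1.good).add (Good.fst.mul ((Good.const (-1)).mul g2.good))
  have N1 : ∀ a ∈ Icc (0:ℝ) 1, ∀ b ∈ Icc (0:ℝ) 1, 1 ≤ (1 + Q a b) + b * ((-1) * K a b) := by
    intro a ha b hb
    have := mul_nonneg hb.1 (neg_nonneg.2 (Kn a ha b hb))
    linarith [Qn a ha b hb]
  have N2 : ∀ a ∈ Icc (0:ℝ) 1, ∀ b ∈ Icc (0:ℝ) 1, 1 ≤ (1 + Q a b) + a * ((-1) * K a b) := by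
    intro a ha b hb
    have := mul_nonneg ha.1 (neg_nonneg.2 (Kn a ha b hb))
    linarith [Qn a ha b hb]
  obtain ⟨A1, hA1, mix1⟩ := G1.log_mixed N1
  obtain ⟨A2, hA2, mix2⟩ := G2.log_mixed N2
  have al : ∀ a ∈ Icc (0:ℝ) 1, ∀ b ∈ Icc (0:ℝ) 1, a ≠ b →
      alphaFun q1 q2 a b + h a = (1 + Q a b) + b * ((-1) * K a b) ∧
      alphaFun q1 q2 a b + h b = (1 + Q a b) + a * ((-1) * K a b) := by
    intro a ha b hb hab
    have e1 : Q a b * (a - b) = q1 a - q1 b := g1.dd_mul ha hb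
    have e2 : K a b * (a - b) = h a - h b := g2.dd_mul ha hb
    have ne : a - b ≠ 0 := sub_ne_zero.2 hab
    have e3 : alphaFun q1 q2 a b = Q a b - h a - b * K a b + 1 := by
      unfold alphaFun fFun
      rw [← hh]
      congr 1
      rw [div_eq_iff ne]
      linear_combination (-1) * e1 + b * e2
    refine ⟨by rw [e3]; ring, mul_right_cancel₀ ne ?_⟩
    rw [e3]
    linear_combination (a - b) * e2
  -- the shock function
  have hS : ∀ a ∈ Icc (0:ℝ) 1, ∀ b ∈ Icc (0:ℝ) 1, SFun q1 q2 a b =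
      Real.log ((1 + Q a b) + b * ((-1) * K a b)) - Real.log ((1 + Q a b) + a * ((-1) * K a b)) := by
    intro a ha b hb
    by_cases hab : a = b
    · subst hab
      unfold SFun
      rw [sub_self]
      by_cases hz : alphaFun q1 q2 a a + hFun q1 q2 a = 0
      · rw [hz]; simp
      · rw [div_self hz]; simp
    · obtain ⟨e1, e2⟩ := al a ha b hb hab
      unfold SFun
      rw [← hh, e1, e2, Real.log_div]
      · linarith [N1 a ha b hb]
      · linarith [N2 a ha b hb]
  have S0 : ∀ a, SFun q1 q2 a a = 0 := by
    intro a
    unfold SFun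
    by_cases hz : alphaFun q1 q2 a a + hFun q1 q2 a = 0
    · rw [hz]; simp
    · rw [div_self hz]; simp
  set E : ℝ → ℝ → ℝ := fun a b => SFun q1 q2 a b - (g b - g a) with hE
  have hmix : ∀ x ∈ Icc (0:ℝ) 1, ∀ y ∈ Icc (0:ℝ) 1, ∀ z ∈ Icc (0:ℝ) 1, ∀ w ∈ Icc (0:ℝ) 1,
      |E x z - E y z - E x w + E y w| ≤ (A1 + A2) * (|x - y| * |z - w|) := by
    intro x hx y hy z hz w hw
    have m1 := mix1 x hx y hy z hz w hw
    have m2 := mix2 x hx y hy z hz w hw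
    have e : E x z - E y z - E x w + E y w = SFun q1 q2 x z - SFun q1 q2 y z
        - SFun q1 q2 x w + SFun q1 q2 y w := by simp only [hE]; ring
    rw [e, hS x hx z hz, hS y hy z hz, hS x hx w hw, hS y hy w hw, add_mul]
    refine le_trans (le_of_eq ?_) ((abs_sub _ _).trans (add_le_add m1 m2))
    congr 1
    ring
  have hquad : ∀ a ∈ Icc (0:ℝ) 1, ∀ b ∈ Icc (0:ℝ) 1, a < b →
      |E a b| ≤ (M2 ^ 2 + (M2 * (1 + M1 + M2) + M2 * (M1 + M2 + M2))) * (b - a) ^ 2 := by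
    intro a ha b hb hab
    have hd : 0 < b - a := sub_pos.2 hab
    obtain ⟨ξ, hξ, hgξ⟩ := exists_hasDerivAt_eq_slope g
      (fun c => -(deriv h c) / HFun q1 q2 c) hab
      (fun c hc => (hg c ⟨ha.1.trans hc.1, hc.2.trans hb.2⟩).continuousAt.continuousWithinAt)
      (fun c hc => hg c ⟨ha.1.trans hc.1.le, hc.2.le.trans hb.2⟩)
    have hξ' : ξ ∈ Icc (0:ℝ) 1 := ⟨ha.1.trans hξ.1.le, hξ.2.le.trans hb.2⟩
    have hgg : g b - g a = -(deriv h ξ) / HFun q1 q2 ξ * (b - a) := by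
      rw [hgξ]; field_simp
    have kq : |Q a b - deriv q1 ξ| ≤ M1 * (b - a) := g1.dd_near ha hb hξ.1.le hξ.2.le
    have kk : |K a b - deriv h ξ| ≤ M2 * (b - a) := g2.dd_near ha hb hξ.1.le hξ.2.le
    have bK : |K a b| ≤ M2 := integral_bd fun t ht => g2.b1 _ (mem_seg ha hb ht)
    have bh : |deriv h ξ| ≤ M2 := g2.b1 ξ hξ'
    have bq : |deriv q1 ξ| ≤ M1 := g1.b1 ξ hξ'
    have n1 := N1 a ha b hb
    have n2 := N2 a ha b hb
    have hK0 := Kn a ha b hb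
    have hHv : HFun q1 q2 ξ = 1 + deriv q1 ξ - ξ * deriv h ξ := rfl
    have hH1 : 1 ≤ HFun q1 q2 ξ := by
      rw [hHv]
      have := mul_nonneg hξ'.1 (neg_nonneg.2 (hh' ξ hξ'))
      linarith [hq1' ξ hξ']
    have hSab := hS a ha b hb
    have hNN : (1 + Q a b) + b * ((-1) * K a b) =
      ((1 + Q a b) + a * ((-1) * K a b)) + (b - a) * (- K a b) := by ring
    have hnv : (1 + Q a b) + a * ((-1) * K a b) = 1 + Q a b - a * K a b := by ring
    rw [hNN] at hSab
    set n := (1 + Q a b) + a * ((-1) * K a b) with hn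
    set k := K a b with hk
    set H := HFun q1 q2 ξ with hHdef
    have npos : 0 < n := by linarith
    have Hpos : 0 < H := by linarith
    set x := (b - a) * (-k) / n with hx
    have x0 : 0 ≤ x := div_nonneg (mul_nonneg hd.le (by linarith)) npos.le
    have xle : x ≤ M2 * (b - a) := by
      have : x ≤ (b - a) * (-k) := div_le_self (mul_nonneg hd.le (by linarith)) n2
      have := (abs_le.1 bK).1
      nlinarith
    have hSx : SFun q1 q2 a b = Real.log (1 + x) := by
      rw [hSab, ← Real.log_div (by nlinarith) npos.ne']
      congr 1
      rw [hx]; field_simp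
    have l1 := log_one_add_bd x0
    have l1' : x ^ 2 ≤ M2 ^ 2 * (b - a) ^ 2 := by
      rw [← mul_pow]; exact pow_le_pow_left₀ x0 xle 2
    have key : ∀ {s t S T : ℝ}, |s| ≤ S → |t| ≤ T → |s * t| ≤ S * T := by
      intro s t S T h1 h2
      rw [abs_mul]
      exact mul_le_mul h1 h2 (abs_nonneg _) ((abs_nonneg _).trans h1)
    have bax : |a - ξ| ≤ b - a := by rw [abs_le]; constructor <;> linarith [hξ.1, hξ.2]
    have ba : |a| ≤ 1 := by rw [abs_of_nonneg ha.1]; exact ha.2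
    have bξ : |ξ| ≤ 1 := by rw [abs_of_nonneg hξ'.1]; exact hξ'.2
    have bnH : |n - H| ≤ (M1 + M2 + M2) * (b - a) := by
      have e : n - H = (Q a b - deriv q1 ξ) - (a * (k - deriv h ξ) + (a - ξ) * deriv h ξ) := by
        rw [hnv, hHv]; ring
      rw [e]
      have t1 := key ba kk
      have t2 := key bax bh
      refine (abs_sub _ _).trans ?_
      have := abs_add_le (a * (k - deriv h ξ)) ((a - ξ) * deriv h ξ)
      linarith
    have bH : |H| ≤ 1 + M1 + M2 := by
      rw [hHv]
      have t := key bξ bh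
      have t' := abs_le.1 t
      have t2 := abs_le.1 bq
      rw [abs_le]
      constructor <;> linarith [t'.1, t'.2, t2.1, t2.2]
    have l2 : |x - (g b - g a)| ≤
        (M2 * (1 + M1 + M2) + M2 * (M1 + M2 + M2)) * (b - a) ^ 2 := by
      have e : x - (g b - g a) =
          (deriv h ξ * (n - H) - (k - deriv h ξ) * H) * (b - a) / (n * H) := by
        rw [hgg, hx]; field_simp; ring
      have nH : 1 ≤ n * H := by nlinarith
      rw [e, abs_div, abs_of_pos (by linarith : 0 < n * H), abs_mul, abs_of_pos hd]
      refine (div_le_self (by positivity) nH).trans ?_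
      have t1 := key bh bnH
      have t2 := key kk bH
      have t3 := (abs_sub (deriv h ξ * (n - H)) ((k - deriv h ξ) * H)).trans (add_le_add t1 t2)
      exact (mul_le_mul_of_nonneg_right t3 hd.le).trans (le_of_eq (by ring))
    have e : E a b = (Real.log (1 + x) - x) + (x - (g b - g a)) := by
      simp only [hE]; rw [hSx]; ring
    rw [e]
    refine (abs_add_le _ _).trans ?_
    rw [add_mul]
    linarith
  set A := A1 + A2 with hA
  set B := M2 ^ 2 + (M2 * (1 + M1 + M2) + M2 * (M1 + M2 + M2)) with hB
  have A0 : 0 ≤ A := by positivity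
  have B0 : 0 ≤ B := by positivity
  refine ⟨2 * (A + B) + 1, by positivity, ?_⟩
  intro c0 h0 c1 h1 c2 h2 L0 L1 L2 L1s w1 w2 w3
  have P : 0 ≤ |c0 - c1| * |c1 - c2| := by positivity
  refine ⟨?_, ?_⟩
  · have := abs_add_le (c1 - c0) (c2 - c1)
    have e : c1 - c0 + (c2 - c1) = c2 - c0 := by ring
    rw [e] at this
    simpa using this
  have T0 : ∀ a, TFun q1 q2 g a a = 0 := by intro a; simp [TFun]
  have nG : 0 ≤ (2 * (A + B) + 1) * |c0 - c1| * |c1 - c2| := by positivity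
  rcases w1 with w1 | w1
  · subst w1
    rcases w2 with w2 | w2
    · subst w2
      rw [T0] at w3
      have e : L1s = L2 := by linarith
      subst e
      have := abs_add_le (L1 - L0) (L1s - L1)
      have e : L1 - L0 + (L1s - L1) = L1s - L0 := by ring
      rw [e] at this
      rw [sub_self L1s, abs_zero]
      linarith
    · have e : L1s = L1 := by linarith
      subst e
      linarith
  rcases w2 with w2 | w2
  · subst w2
    have e1 : L2 - L1s = L1 - L0 := by linarith
    have e2 : L1s - L0 = L2 - L1 := by linarith
    rw [e1, e2]
    linarith
  have D := defect (E := E) (R := fun a b => TFun q1 q2 g a b - (g b - g a)) A0 B0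
    (fun a => by simp [hE, S0]) hmix hquad
    (fun a b hab => by simp [TFun, hab]) (fun a b hab => by simp [TFun, hE, not_le.2 hab]) h0 h1 h2
  have e : (TFun q1 q2 g c2 c1 - (g c1 - g c2)) + (TFun q1 q2 g c1 c0 - (g c0 - g c1))
      - (TFun q1 q2 g c2 c0 - (g c0 - g c2)) = L1s - L0 := by
    rw [← w1, ← w2, ← w3]; ring
  simp only [e] at D
  have t1 := abs_sub (L2 - L0) (L1s - L0)
  have t2 := abs_add_le (L1 - L0) (L2 - L1)
  have e1 : L2 - L0 - (L1s - L0) = L2 - L1s := by ring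
  have e2 : L1 - L0 + (L2 - L1) = L2 - L0 := by ring
  rw [e1] at t1
  rw [e2] at t2
  nlinarith
end

section
/- Assume q1, q2 are C⁴ on a neighborhood of [0,1] with q1' ≥ 0, q2' ≤ 0, h' ≤ 0 and f'' > 0 on [0,1], and assume in addition that the λ-wave curves are monotonous, i.e. ∂S/∂c_-(a,b) ≥ 0 ≥ ∂S/∂c_+(a,b) for all 0 ≤ a < b ≤ 1. Then there exists a constant Γ > 0 such that for all c_0, c_1, c_2 ∈ [0,1] and all L_0, L_1, L_2, L_1* ∈ ℝ satisfying: (i) for i = 0 and i = 1, either c_{i+1} = c_i or L_{i+1} − L_i = T(c_{i+1},c_i); and (ii) L_2 − L_1* = T(c_2,c_0); one has |L_1* − L_0| + |L_2 − L_1*| ≤ |L_1 − L_0| + |L_2 − L_1| + Γ·max(0, c_0 − c_1)·max(0, c_1 − c_2). If moreover S satisfies the triangular inequality S(c_2,c_0) ≤ S(c_2,c_1) + S(c_1,c_0) whenever c_2 < c_1 < c_0, then |L_1* − L_0| + |L_2 − L_1*| ≤ |L_1 − L_0| + |L_2 − L_1|. -/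
open Set

lemma psa_lower (q1 q2 : ℝ → ℝ) (m1 : MonotoneOn q1 (Icc 0 1))
    (m2 : AntitoneOn (hFun q1 q2) (Icc 0 1)) (a b : ℝ) (ha : 0 ≤ a) (hab : a < b) (hb : b ≤ 1) :
    1 ≤ alphaFun q1 q2 a b + hFun q1 q2 a ∧ 1 ≤ alphaFun q1 q2 a b + hFun q1 q2 b := by
  have haI : a ∈ Icc (0:ℝ) 1 := ⟨ha, by linarith⟩
  have hbI : b ∈ Icc (0:ℝ) 1 := ⟨by linarith, hb⟩
  have h1 := m1 haI hbI hab.le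
  have h2 := m2 haI hbI hab.le
  have hne : a - b ≠ 0 := by linarith
  have hne' : b - a ≠ 0 := by linarith
  have e1 : alphaFun q1 q2 a b + hFun q1 q2 a
      = 1 + ((q1 b - q1 a) + b * (hFun q1 q2 a - hFun q1 q2 b)) / (b - a) := by
    unfold alphaFun fFun
    rw [← neg_sub b a]
    field_simp
    ring
  have e2 : alphaFun q1 q2 a b + hFun q1 q2 b
      = 1 + ((q1 b - q1 a) + a * (hFun q1 q2 a - hFun q1 q2 b)) / (b - a) := by
    unfold alphaFun fFun
    rw [← neg_sub b a]
    field_simp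
    ring
  rw [e1, e2]
  have p1 : 0 ≤ ((q1 b - q1 a) + b * (hFun q1 q2 a - hFun q1 q2 b)) / (b - a) := by
    apply div_nonneg _ (by linarith)
    have := mul_nonneg hbI.1 (sub_nonneg.2 h2)
    linarith
  have p2 : 0 ≤ ((q1 b - q1 a) + a * (hFun q1 q2 a - hFun q1 q2 b)) / (b - a) := by
    apply div_nonneg _ (by linarith)
    have := mul_nonneg haI.1 (sub_nonneg.2 h2)
    linarith
  constructor <;> linarith

/-- Algebraic core of the triangle defect estimate. -/
lemma psa_defect (m u v d s t : ℝ) (hu : 0 ≤ u) (hv : 0 ≤ v) (hd : 0 ≤ d) (hs : 0 ≤ s)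
    (ht : 0 ≤ t) (h1 : 1 ≤ m + u) (h2 : 1 ≤ m - v) (h3 : 1 ≤ m - t * d + u)
    (h4 : 1 ≤ m - t * d) (h5 : 1 ≤ m + s * d) (h6 : 1 ≤ m + s * d - v) :
    Real.log ((m + u) / (m - v)) - Real.log ((m - t * d + u) / (m - t * d))
      - Real.log ((m + s * d) / (m + s * d - v)) ≤ v * (s * d) := by
  rw [← Real.log_div (by positivity) (by positivity),
    ← Real.log_div (by positivity) (by positivity)]
  have hpos : 0 < (m + u) / (m - v) / ((m - t * d + u) / (m - t * d))
      / ((m + s * d) / (m + s * d - v)) := by positivity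
  have hl := Real.log_le_sub_one_of_pos hpos
  refine hl.trans ?_
  have e : (m + u) / (m - v) / ((m - t * d + u) / (m - t * d))
      / ((m + s * d) / (m + s * d - v)) - 1
      = (v * (s * d) * (m - t * d + u) - u * (t * d) * (m + s * d - v))
        / ((m - v) * (m - t * d + u) * (m + s * d)) := by
    have : m - v ≠ 0 := by positivity
    have : m - t * d + u ≠ 0 := by positivity
    have : m - t * d ≠ 0 := by positivity
    have : m + s * d ≠ 0 := by positivity
    have : m + s * d - v ≠ 0 := by positivity
    generalize s * d = r at *
    generalize t * d = p at *
    field_simp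
    ring
  rw [e, div_le_iff₀ (by positivity)]
  have k1 : 0 ≤ u * (t * d) * (m + s * d - v) := by positivity
  have k2 : 0 ≤ v * (s * d) * (m - t * d + u) := by positivity
  have k3 : 1 ≤ (m - v) * (m + s * d) := by nlinarith
  nlinarith [mul_le_mul_of_nonneg_left k3 k2]

/-- Case analysis of the interactions. -/
lemma psa_core (q1 q2 g : ℝ → ℝ) (Γ : ℝ) (hΓ : 0 ≤ Γ) (mg : MonotoneOn g (Icc 0 1))
    (Spos : ∀ a b : ℝ, 0 ≤ a → a < b → b ≤ 1 → 0 ≤ SFun q1 q2 a b)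
    (S1 : ∀ a b c : ℝ, 0 ≤ a → a < b → b ≤ c → c ≤ 1 → SFun q1 q2 a b ≤ SFun q1 q2 a c)
    (S2 : ∀ a b c : ℝ, 0 ≤ a → a ≤ b → b < c → c ≤ 1 → SFun q1 q2 b c ≤ SFun q1 q2 a c)
    (tri : ∀ a b c : ℝ, 0 ≤ a → a < b → b < c → c ≤ 1 →
      2 * SFun q1 q2 a c ≤ 2 * (SFun q1 q2 a b + SFun q1 q2 b c) + Γ * (c - b) * (b - a)) :
    ∀ c0 ∈ Icc (0:ℝ) 1, ∀ c1 ∈ Icc (0:ℝ) 1, ∀ c2 ∈ Icc (0:ℝ) 1,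
      ∀ L0 L1 L2 L1s : ℝ,
      (c1 = c0 ∨ L1 - L0 = TFun q1 q2 g c1 c0) →
      (c2 = c1 ∨ L2 - L1 = TFun q1 q2 g c2 c1) →
      L2 - L1s = TFun q1 q2 g c2 c0 →
      |L1s - L0| + |L2 - L1s| ≤ |L1 - L0| + |L2 - L1|
        + Γ * max 0 (c0 - c1) * max 0 (c1 - c2) := by
  intro c0 h0 c1 h1 c2 h2 L0 L1 L2 L1s ha hb hc
  have hE : 0 ≤ Γ * max 0 (c0 - c1) * max 0 (c1 - c2) := by positivity
  rcases ha with rfl | ha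
  · rcases hb with rfl | hb
    · have : TFun q1 q2 g c2 c2 = 0 := by simp [TFun]
      rw [this] at hc
      have h3 : L1s - L0 = (L1 - L0) + (L2 - L1) := by linarith
      rw [hc, h3]
      have := abs_add_le (L1 - L0) (L2 - L1)
      simp only [abs_zero]
      linarith
    · have : L1s = L1 := by linarith
      subst this
      linarith
  rcases hb with rfl | hb
  · have h3 : L2 - L1s = L1 - L0 := by linarith
    have h4 : L1s - L0 = L2 - L1 := by linarith
    rw [h3, h4]
    linarith
  have h3 : L1s - L0 = TFun q1 q2 g c1 c0 + TFun q1 q2 g c2 c1 - TFun q1 q2 g c2 c0 := by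
    linarith
  rw [h3, ha, hb, hc]
  clear h3 ha hb hc
  unfold TFun
  rcases le_or_gt c0 c1 with h01 | h01
  · have g01 := mg h0 h1 h01
    rw [if_pos h01]
    rcases le_or_gt c1 c2 with h12 | h12
    · have g12 := mg h1 h2 h12
      rw [if_pos h12, if_pos (h01.trans h12)]
      rw [abs_of_nonpos (by linarith : g c0 - g c1 ≤ 0),
        abs_of_nonpos (by linarith : g c1 - g c2 ≤ 0),
        abs_of_nonpos (by linarith : g c0 - g c2 ≤ 0),
        show g c0 - g c1 + (g c1 - g c2) - (g c0 - g c2) = 0 by ring, abs_zero]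
      linarith
    · have g12 := mg h2 h1 h12.le
      have p := Spos c2 c1 h2.1 h12 h1.2
      rw [if_neg (not_le.2 h12), abs_of_nonpos (by linarith : g c0 - g c1 ≤ 0), abs_of_nonneg p]
      split_ifs with h02
      · have g02 := mg h0 h2 h02
        rw [abs_of_nonpos (by linarith : g c0 - g c2 ≤ 0)]
        have : |g c0 - g c1 + SFun q1 q2 c2 c1 - (g c0 - g c2)|
            ≤ SFun q1 q2 c2 c1 + (g c1 - g c2) := by
          rw [abs_le]; constructor <;> linarith
        linarith
      · push Not at h02
        have p0 := Spos c2 c0 h2.1 h02 h0.2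
        have p1 := S1 c2 c0 c1 h2.1 h02 h01 h1.2
        rw [abs_of_nonneg p0]
        have : |g c0 - g c1 + SFun q1 q2 c2 c1 - SFun q1 q2 c2 c0|
            ≤ SFun q1 q2 c2 c1 - SFun q1 q2 c2 c0 + (g c1 - g c0) := by
          rw [abs_le]; constructor <;> linarith
        linarith
  · have g01 := mg h1 h0 h01.le
    have pA := Spos c1 c0 h1.1 h01 h0.2
    rw [if_neg (not_le.2 h01), abs_of_nonneg pA]
    rcases le_or_gt c1 c2 with h12 | h12
    · have g12 := mg h1 h2 h12
      rw [if_pos h12, abs_of_nonpos (by linarith : g c1 - g c2 ≤ 0)]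
      split_ifs with h02
      · have g02 := mg h0 h2 h02
        rw [abs_of_nonpos (by linarith : g c0 - g c2 ≤ 0)]
        have : |SFun q1 q2 c1 c0 + (g c1 - g c2) - (g c0 - g c2)|
            ≤ SFun q1 q2 c1 c0 + (g c0 - g c1) := by
          rw [abs_le]; constructor <;> linarith
        linarith
      · push Not at h02
        have p0 := Spos c2 c0 h2.1 h02 h0.2
        have p1 := S2 c1 c2 c0 h1.1 h12 h02 h0.2
        rw [abs_of_nonneg p0]
        have : |SFun q1 q2 c1 c0 + (g c1 - g c2) - SFun q1 q2 c2 c0|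
            ≤ SFun q1 q2 c1 c0 - SFun q1 q2 c2 c0 + (g c2 - g c1) := by
          rw [abs_le]; constructor <;> linarith
        linarith
    · have pB := Spos c2 c1 h2.1 h12 h1.2
      have pC := Spos c2 c0 h2.1 (h12.trans h01) h0.2
      have ht := tri c2 c1 c0 h2.1 h12 h01 h0.2
      rw [if_neg (not_le.2 h12), if_neg (not_le.2 (h12.trans h01)), abs_of_nonneg pB,
        abs_of_nonneg pC]
      rw [max_eq_right (by linarith : 0 ≤ c0 - c1), max_eq_right (by linarith : 0 ≤ c1 - c2)]
        at hE ⊢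
      have : |SFun q1 q2 c1 c0 + SFun q1 q2 c2 c1 - SFun q1 q2 c2 c0|
            ≤ SFun q1 q2 c1 c0 + SFun q1 q2 c2 c1 - SFun q1 q2 c2 c0
              + Γ * (c0 - c1) * (c1 - c2) := by
        rw [abs_le]; constructor <;> linarith
      linarith

/-- Triangle defect for `S`. -/
lemma psa_tri (q1 q2 : ℝ → ℝ) (M N : ℝ) (m1 : MonotoneOn q1 (Icc 0 1))
    (m2 : AntitoneOn (hFun q1 q2) (Icc 0 1))
    (hM : ∀ x y : ℝ, 0 ≤ x → x < y → y ≤ 1 → hFun q1 q2 x - hFun q1 q2 y ≤ M * (y - x))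
    (hN : ∀ a b c : ℝ, 0 ≤ a → a < b → b < c → c ≤ 1 →
      0 ≤ alphaFun q1 q2 b c - alphaFun q1 q2 a b ∧
      alphaFun q1 q2 b c - alphaFun q1 q2 a b ≤ N * (c - a))
    (a b c : ℝ) (ha : 0 ≤ a) (hab : a < b) (hbc : b < c) (hc : c ≤ 1) :
    SFun q1 q2 a c ≤ SFun q1 q2 a b + SFun q1 q2 b c + M * N * (c - b) * (b - a) := by
  have haI : a ∈ Icc (0:ℝ) 1 := ⟨ha, by linarith⟩
  have hbI : b ∈ Icc (0:ℝ) 1 := ⟨by linarith, by linarith⟩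
  have hcI : c ∈ Icc (0:ℝ) 1 := ⟨by linarith, hc⟩
  obtain ⟨n1, n2⟩ := hN a b c ha hab hbc hc
  have l1 := psa_lower q1 q2 m1 m2 a b ha hab hbI.2
  have l2 := psa_lower q1 q2 m1 m2 b c hbI.1 hbc hc
  have l3 := psa_lower q1 q2 m1 m2 a c ha (hab.trans hbc) hc
  have mh := hM b c hbI.1 hbc hc
  have hca : 0 < c - a := by linarith
  set d := (alphaFun q1 q2 b c - alphaFun q1 q2 a b) / (c - a) with hd
  have hd0 : 0 ≤ d := div_nonneg n1 hca.le
  have hdN : d ≤ N := by rw [hd, div_le_iff₀ hca]; exact n2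
  have ecomb : alphaFun q1 q2 a c * (c - a)
      = alphaFun q1 q2 a b * (b - a) + alphaFun q1 q2 b c * (c - b) := by
    have x1 : a - b ≠ 0 := by linarith
    have x2 : b - c ≠ 0 := by linarith
    have x3 : a - c ≠ 0 := by linarith
    have y1 : alphaFun q1 q2 a b * (a - b) = fFun q1 q2 a - fFun q1 q2 b + (a - b) := by
      unfold alphaFun; field_simp
    have y2 : alphaFun q1 q2 b c * (b - c) = fFun q1 q2 b - fFun q1 q2 c + (b - c) := by
      unfold alphaFun; field_simp
    have y3 : alphaFun q1 q2 a c * (a - c) = fFun q1 q2 a - fFun q1 q2 c + (a - c) := by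
      unfold alphaFun; field_simp
    linarith
  have ea : alphaFun q1 q2 a b = alphaFun q1 q2 a c - (c - b) * d := by
    rw [hd]; field_simp; linear_combination -ecomb
  have eb : alphaFun q1 q2 b c = alphaFun q1 q2 a c + (b - a) * d := by
    rw [hd]; field_simp; linear_combination -ecomb
  have u0 := m2 haI hbI hab.le
  have v0 := m2 hbI hcI hbc.le
  have key := psa_defect (alphaFun q1 q2 a c + hFun q1 q2 b) (hFun q1 q2 a - hFun q1 q2 b)
    (hFun q1 q2 b - hFun q1 q2 c) d (b - a) (c - b) (by linarith) (by linarith) hd0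
    (by linarith) (by linarith) (by linarith) (by linarith) (by linarith) (by linarith)
    (by linarith) (by linarith)
  have s1 : SFun q1 q2 a c = Real.log ((alphaFun q1 q2 a c + hFun q1 q2 b
      + (hFun q1 q2 a - hFun q1 q2 b)) / (alphaFun q1 q2 a c + hFun q1 q2 b
      - (hFun q1 q2 b - hFun q1 q2 c))) := by
    unfold SFun; congr 2 <;> ring
  have s2 : SFun q1 q2 a b = Real.log ((alphaFun q1 q2 a c + hFun q1 q2 b - (c - b) * d
      + (hFun q1 q2 a - hFun q1 q2 b)) / (alphaFun q1 q2 a c + hFun q1 q2 b - (c - b) * d)) := by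
    unfold SFun; rw [ea]; congr 2 <;> ring
  have s3 : SFun q1 q2 b c = Real.log ((alphaFun q1 q2 a c + hFun q1 q2 b + (b - a) * d)
      / (alphaFun q1 q2 a c + hFun q1 q2 b + (b - a) * d
      - (hFun q1 q2 b - hFun q1 q2 c))) := by
    unfold SFun; rw [eb]; congr 2 <;> ring
  rw [← s1, ← s2, ← s3] at key
  have fin : (hFun q1 q2 b - hFun q1 q2 c) * ((b - a) * d)
      ≤ (M * (c - b)) * ((b - a) * N) := by
    have : 0 ≤ b - a := by linarith
    have : 0 ≤ hFun q1 q2 b - hFun q1 q2 c := by linarith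
    have : 0 ≤ M * (c - b) := by linarith
    gcongr
  linarith [fin, key]

/-- Interaction estimate (Theorem 6.1, parts 2 and 3): with monotonous λ-wave
curves the increase of `TV(log u)` is controlled by `Γ·(c₁-c₀)₋·(c₂-c₁)₋`, and
under the triangular inequality for `S` the total variation of `log u` does
not increase at all. -/
theorem interaction_estimate_monotone_wave_curves
    (q1 q2 g : ℝ → ℝ)
    (hreg : ∃ U : Set ℝ, IsOpen U ∧ Icc (0:ℝ) 1 ⊆ U ∧
      ContDiffOn ℝ 4 q1 U ∧ ContDiffOn ℝ 4 q2 U)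
    (hq1' : ∀ c ∈ Icc (0:ℝ) 1, 0 ≤ deriv q1 c)
    (hq2' : ∀ c ∈ Icc (0:ℝ) 1, deriv q2 c ≤ 0)
    (hh' : ∀ c ∈ Icc (0:ℝ) 1, deriv (hFun q1 q2) c ≤ 0)
    (hf'' : ∀ c ∈ Icc (0:ℝ) 1, 0 < deriv (deriv (fFun q1 q2)) c)
    (hg : ∀ c ∈ Icc (0:ℝ) 1,
      HasDerivAt g (-(deriv (hFun q1 q2) c) / HFun q1 q2 c) c)
    (hmon : ∀ a b : ℝ, 0 ≤ a → a < b → b ≤ 1 →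
      0 ≤ deriv (fun y => SFun q1 q2 a y) b ∧ deriv (fun x => SFun q1 q2 x b) a ≤ 0) :
    (∃ Γ > 0, ∀ c0 ∈ Icc (0:ℝ) 1, ∀ c1 ∈ Icc (0:ℝ) 1, ∀ c2 ∈ Icc (0:ℝ) 1,
      ∀ L0 L1 L2 L1s : ℝ,
      (c1 = c0 ∨ L1 - L0 = TFun q1 q2 g c1 c0) →
      (c2 = c1 ∨ L2 - L1 = TFun q1 q2 g c2 c1) →
      L2 - L1s = TFun q1 q2 g c2 c0 →
      |L1s - L0| + |L2 - L1s| ≤ |L1 - L0| + |L2 - L1|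
        + Γ * max 0 (c0 - c1) * max 0 (c1 - c2)) ∧
    ((∀ a b c : ℝ, 0 ≤ a → a < b → b < c → c ≤ 1 →
        SFun q1 q2 a c ≤ SFun q1 q2 a b + SFun q1 q2 b c) →
      ∀ c0 ∈ Icc (0:ℝ) 1, ∀ c1 ∈ Icc (0:ℝ) 1, ∀ c2 ∈ Icc (0:ℝ) 1,
      ∀ L0 L1 L2 L1s : ℝ,
      (c1 = c0 ∨ L1 - L0 = TFun q1 q2 g c1 c0) →
      (c2 = c1 ∨ L2 - L1 = TFun q1 q2 g c2 c1) →
      L2 - L1s = TFun q1 q2 g c2 c0 →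
      |L1s - L0| + |L2 - L1s| ≤ |L1 - L0| + |L2 - L1|) := by
  obtain ⟨U, hU, hIU, r1, r2⟩ := hreg
  have rh : ContDiffOn ℝ 4 (hFun q1 q2) U := r1.add r2
  have rf : ContDiffOn ℝ 4 (fFun q1 q2) U := r1.sub (contDiffOn_id.mul rh)
  have d1 : ∀ x ∈ Icc (0:ℝ) 1, DifferentiableAt ℝ q1 x := fun x hx =>
    (r1.contDiffAt (hU.mem_nhds (hIU hx))).differentiableAt (by norm_num)
  have dh : ∀ x ∈ Icc (0:ℝ) 1, DifferentiableAt ℝ (hFun q1 q2) x := fun x hx =>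
    (rh.contDiffAt (hU.mem_nhds (hIU hx))).differentiableAt (by norm_num)
  have df : ∀ x ∈ Icc (0:ℝ) 1, DifferentiableAt ℝ (fFun q1 q2) x := fun x hx =>
    (rf.contDiffAt (hU.mem_nhds (hIU hx))).differentiableAt (by norm_num)
  have rh' : ContDiffOn ℝ 3 (deriv (hFun q1 q2)) U := rh.deriv_of_isOpen hU (by norm_num)
  have rf' : ContDiffOn ℝ 3 (deriv (fFun q1 q2)) U := rf.deriv_of_isOpen hU (by norm_num)
  have rf'' : ContDiffOn ℝ 2 (deriv (deriv (fFun q1 q2))) U :=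
    rf'.deriv_of_isOpen hU (by norm_num)
  have df' : ∀ x ∈ Icc (0:ℝ) 1, DifferentiableAt ℝ (deriv (fFun q1 q2)) x := fun x hx =>
    (rf'.contDiffAt (hU.mem_nhds (hIU hx))).differentiableAt (by norm_num)
  obtain ⟨M, hMb⟩ := isCompact_Icc.exists_bound_of_continuousOn (rh'.continuousOn.mono hIU)
  obtain ⟨N, hNb⟩ := isCompact_Icc.exists_bound_of_continuousOn (rf''.continuousOn.mono hIU)
  have hM0 : 0 ≤ M := (norm_nonneg _).trans (hMb 0 (by simp))
  have hN0 : 0 ≤ N := (norm_nonneg _).trans (hNb 0 (by simp))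
  have m1 : MonotoneOn q1 (Icc 0 1) := by
    apply monotoneOn_of_deriv_nonneg (convex_Icc 0 1)
      (fun x hx => (d1 x hx).continuousAt.continuousWithinAt)
      (fun x hx => (d1 x (interior_subset hx)).differentiableWithinAt)
      (fun x hx => hq1' x (interior_subset hx))
  have m2 : AntitoneOn (hFun q1 q2) (Icc 0 1) := by
    apply antitoneOn_of_deriv_nonpos (convex_Icc 0 1)
      (fun x hx => (dh x hx).continuousAt.continuousWithinAt)
      (fun x hx => (dh x (interior_subset hx)).differentiableWithinAt)
      (fun x hx => hh' x (interior_subset hx))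
  have mg : MonotoneOn g (Icc 0 1) := by
    apply monotoneOn_of_deriv_nonneg (convex_Icc 0 1)
      (fun x hx => (hg x hx).continuousAt.continuousWithinAt)
      (fun x hx => (hg x (interior_subset hx)).differentiableAt.differentiableWithinAt)
    intro x hx
    have hx := interior_subset hx
    rw [(hg x hx).deriv]
    have := hq1' x hx
    have := hh' x hx
    apply div_nonneg (by linarith)
    unfold HFun
    nlinarith [hx.1]
  have low := psa_lower q1 q2 m1 m2
  have Spos : ∀ a b : ℝ, 0 ≤ a → a < b → b ≤ 1 → 0 ≤ SFun q1 q2 a b := by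
    intro a b ha hab hb
    obtain ⟨l1, l2⟩ := low a b ha hab hb
    have := m2 (show a ∈ Icc (0:ℝ) 1 from ⟨ha, by linarith⟩)
      (show b ∈ Icc (0:ℝ) 1 from ⟨by linarith, hb⟩) hab.le
    apply Real.log_nonneg
    rw [le_div_iff₀ (by linarith)]
    linarith
  have DS1 : ∀ a b : ℝ, 0 ≤ a → a < b → b ≤ 1 →
      DifferentiableAt ℝ (fun y => SFun q1 q2 a y) b := by
    intro a b ha hab hb
    obtain ⟨l1, l2⟩ := low a b ha hab hb
    have hbI : b ∈ Icc (0:ℝ) 1 := ⟨by linarith, hb⟩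
    have e1 := df b hbI
    have e2 := dh b hbI
    have eα : DifferentiableAt ℝ (fun y => alphaFun q1 q2 a y) b := by
      unfold alphaFun
      exact (((differentiableAt_const _).sub e1).div
        ((differentiableAt_const _).sub differentiableAt_id) (by simp; linarith)).add_const _
    unfold SFun
    apply DifferentiableAt.log
    · exact (eα.add_const _).div (eα.add e2) (by simp; linarith)
    · exact (div_pos (by linarith) (by linarith)).ne'
  have DS2 : ∀ a b : ℝ, 0 ≤ a → a < b → b ≤ 1 →
      DifferentiableAt ℝ (fun x => SFun q1 q2 x b) a := by
    intro a b ha hab hb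
    obtain ⟨l1, l2⟩ := low a b ha hab hb
    have haI : a ∈ Icc (0:ℝ) 1 := ⟨ha, by linarith⟩
    have e1 := df a haI
    have e2 := dh a haI
    have eα : DifferentiableAt ℝ (fun x => alphaFun q1 q2 x b) a := by
      unfold alphaFun
      exact ((e1.sub (differentiableAt_const _)).div
        (differentiableAt_id.sub (differentiableAt_const _)) (by simp; linarith)).add_const _
    unfold SFun
    apply DifferentiableAt.log
    · exact (eα.add e2).div (eα.add_const _) (by simp; linarith)
    · exact (div_pos (by linarith) (by linarith)).ne'
  have S1 : ∀ a b c : ℝ, 0 ≤ a → a < b → b ≤ c → c ≤ 1 →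
      SFun q1 q2 a b ≤ SFun q1 q2 a c := by
    intro a b c ha hab hbc hc
    have D : ∀ y ∈ Icc b c, DifferentiableAt ℝ (fun y => SFun q1 q2 a y) y := fun y hy =>
      DS1 a y ha (hab.trans_le hy.1) (hy.2.trans hc)
    have : MonotoneOn (fun y => SFun q1 q2 a y) (Icc b c) :=
      monotoneOn_of_deriv_nonneg (convex_Icc b c)
        (fun x hx => (D x hx).continuousAt.continuousWithinAt)
        (fun x hx => (D x (interior_subset hx)).differentiableWithinAt)
        (fun x hx => (hmon a x ha (hab.trans_le (interior_subset hx).1)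
          ((interior_subset hx).2.trans hc)).1)
    exact this (left_mem_Icc.2 hbc) (right_mem_Icc.2 hbc) hbc
  have S2 : ∀ a b c : ℝ, 0 ≤ a → a ≤ b → b < c → c ≤ 1 →
      SFun q1 q2 b c ≤ SFun q1 q2 a c := by
    intro a b c ha hab hbc hc
    have D : ∀ x ∈ Icc a b, DifferentiableAt ℝ (fun x => SFun q1 q2 x c) x := fun x hx =>
      DS2 x c (ha.trans hx.1) (hx.2.trans_lt hbc) hc
    have : AntitoneOn (fun x => SFun q1 q2 x c) (Icc a b) :=
      antitoneOn_of_deriv_nonpos (convex_Icc a b)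
        (fun x hx => (D x hx).continuousAt.continuousWithinAt)
        (fun x hx => (D x (interior_subset hx)).differentiableWithinAt)
        (fun x hx => (hmon x c (ha.trans (interior_subset hx).1)
          ((interior_subset hx).2.trans_lt hbc) hc).2)
    exact this (left_mem_Icc.2 hab) (right_mem_Icc.2 hab) hab
  have hM : ∀ x y : ℝ, 0 ≤ x → x < y → y ≤ 1 →
      hFun q1 q2 x - hFun q1 q2 y ≤ M * (y - x) := by
    intro x y hx hxy hy
    have hs : Icc x y ⊆ Icc (0:ℝ) 1 := Icc_subset_Icc hx hy
    obtain ⟨z, hz, e⟩ := exists_deriv_eq_slope (hFun q1 q2) hxy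
      (fun w hw => (dh w (hs hw)).continuousAt.continuousWithinAt)
      (fun w hw => (dh w (hs (Ioo_subset_Icc_self hw))).differentiableWithinAt)
    have hb := hMb z (hs (Ioo_subset_Icc_self hz))
    rw [Real.norm_eq_abs, abs_le] at hb
    have hyx : 0 < y - x := by linarith
    have e' := (eq_div_iff hyx.ne').1 e
    nlinarith [hb.1]
  have mvt : ∀ a b : ℝ, 0 ≤ a → a < b → b ≤ 1 →
      ∃ z ∈ Ioo a b, alphaFun q1 q2 a b = deriv (fFun q1 q2) z + 1 := by
    intro x y hx hxy hy
    have hs : Icc x y ⊆ Icc (0:ℝ) 1 := Icc_subset_Icc hx hy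
    obtain ⟨z, hz, e⟩ := exists_deriv_eq_slope (fFun q1 q2) hxy
      (fun w hw => (df w (hs hw)).continuousAt.continuousWithinAt)
      (fun w hw => (df w (hs (Ioo_subset_Icc_self hw))).differentiableWithinAt)
    refine ⟨z, hz, ?_⟩
    rw [e]
    unfold alphaFun
    rw [← neg_sub y x, ← neg_sub (fFun q1 q2 y) (fFun q1 q2 x), neg_div_neg_eq]
  have hN : ∀ a b c : ℝ, 0 ≤ a → a < b → b < c → c ≤ 1 →
      0 ≤ alphaFun q1 q2 b c - alphaFun q1 q2 a b ∧
      alphaFun q1 q2 b c - alphaFun q1 q2 a b ≤ N * (c - a) := by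
    intro a b c ha hab hbc hc
    obtain ⟨x, hx, ex⟩ := mvt a b ha hab (by linarith)
    obtain ⟨y, hy, ey⟩ := mvt b c (by linarith) hbc hc
    have hxy : x < y := hx.2.trans hy.1
    have hs : Icc x y ⊆ Icc (0:ℝ) 1 :=
      Icc_subset_Icc (by linarith [hx.1]) (by linarith [hy.2])
    obtain ⟨z, hz, e⟩ := exists_deriv_eq_slope (deriv (fFun q1 q2)) hxy
      (fun w hw => (df' w (hs hw)).continuousAt.continuousWithinAt)
      (fun w hw => (df' w (hs (Ioo_subset_Icc_self hw))).differentiableWithinAt)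
    have hzI := hs (Ioo_subset_Icc_self hz)
    have hb := hNb z hzI
    rw [Real.norm_eq_abs, abs_le] at hb
    have hp := hf'' z hzI
    have hyx : 0 < y - x := by linarith
    have e' := (eq_div_iff hyx.ne').1 e
    rw [ex, ey]
    have k1 := mul_le_mul_of_nonneg_right hb.2 hyx.le
    have k2 : N * (y - x) ≤ N * (c - a) :=
      mul_le_mul_of_nonneg_left (by linarith [hx.1, hy.2]) hN0
    have k3 := mul_pos hp hyx
    constructor <;> linarith
  constructor
  · refine ⟨2 * (M * N) + 1, by positivity, ?_⟩
    apply psa_core q1 q2 g _ (by positivity) mg Spos S1 S2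
    intro a b c ha hab hbc hc
    have := psa_tri q1 q2 M N m1 m2 hM hN a b c ha hab hbc hc
    have k : 0 ≤ (c - b) * (b - a) := mul_nonneg (by linarith) (by linarith)
    linarith
  · intro tri c0 h0 c1 h1 c2 h2 L0 L1 L2 L1s ha hb hc
    have := psa_core q1 q2 g 0 le_rfl mg Spos S1 S2
      (fun a b c ha hab hbc hc => by linarith [tri a b c ha hab hbc hc])
      c0 h0 c1 h1 c2 h2 L0 L1 L2 L1s ha hb hc
    simpa using this
end
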